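/- For every integer n ≥ 1, the sum over all fully commutative involutions w of the Coxeter group of type B_n of q^{maj(w)} equals Σ_{h=1}^{n} q^h Σ_{i=0}^{h−1} [h−1 choose i]_q + [n choose ⌊n/2⌋]_q, as polynomials in q. -/

import Mathlib

open CoxeterSystem

/-- A single commutation move: transposition of two adjacent letters `a`, `b`
with `M a b = 2`. -/
def CommMove {B : Type*} (M : CoxeterMatrix B) (w w' : List B) : Prop :=
  ∃ (u v : List B) (a b : B), M a b = 2 ∧ w = u ++ a :: b :: v ∧ w' = u ++ b :: a :: v

/-- Commutation equivalence of words: two words are commutation-equivalent if one can be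
obtained from the other by a sequence of transpositions of adjacent commuting letters. -/
def CommEquiv {B : Type*} (M : CoxeterMatrix B) : List B → List B → Prop :=
  Relation.EqvGen (CommMove M)

/-- An element is fully commutative if all its reduced words are commutation-equivalent. -/
def IsFullyCommutative {B W : Type*} [Group W] {M : CoxeterMatrix B}
    (cs : CoxeterSystem M W) (w : W) : Prop :=
  ∀ u v : List B, cs.IsReduced u → cs.wordProd u = w →
    cs.IsReduced v → cs.wordProd v = w → CommEquiv M u v

/-- A fully commutative involution (the identity is allowed). -/
def IsFCInvolution {B W : Type*} [Group W] {M : CoxeterMatrix B}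
    (cs : CoxeterSystem M W) (w : W) : Prop :=
  IsFullyCommutative cs w ∧ w * w = 1

/-- The Coxeter matrix of type `B_n`: generators `s_1, …, s_n` (index `k : Fin n`
corresponds to `s_{k+1}`), with `m(s_i, s_{i+1}) = 3` for `1 ≤ i ≤ n-2`,
`m(s_{n-1}, s_n) = 4`, and `m(s_i, s_j) = 2` for non-adjacent pairs. -/
def typeB (n : ℕ) : CoxeterMatrix (Fin n) where
  M := Matrix.of fun i j : Fin n =>
    if (i : ℕ) = (j : ℕ) then 1
    else if (i : ℕ) + 1 = (j : ℕ) ∨ (j : ℕ) + 1 = (i : ℕ) then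
      (if (i : ℕ) + 1 = n ∨ (j : ℕ) + 1 = n then 4 else 3)
    else 2
  isSymm := by
    ext i j
    simp only [Matrix.transpose_apply, Matrix.of_apply]
    split_ifs <;> omega
  diagonal := by intro i; simp [Matrix.of_apply]
  off_diagonal := by
    intro i j hij
    have h : (i : ℕ) ≠ (j : ℕ) := fun h => hij (Fin.ext h)
    simp only [Matrix.of_apply]
    split_ifs <;> omega

/-- The right descent set of `w`, as a finset of indices: those `i` with
`ℓ(w sᵢ) < ℓ(w)`. -/
noncomputable def rightDescents {n : ℕ} {W : Type*} [Group W] {M : CoxeterMatrix (Fin n)}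
    (cs : CoxeterSystem M W) (w : W) : Finset (Fin n) :=
  Finset.univ.filter fun i => cs.length (w * cs.simple i) < cs.length w

/-- The major index of `w`: the sum of the labels of its right descents, where the
index `k : Fin n` corresponds to the generator `s_{k+1}` (hence has label `k + 1`). -/
noncomputable def majorIndex {n : ℕ} {W : Type*} [Group W] {M : CoxeterMatrix (Fin n)}
    (cs : CoxeterSystem M W) (w : W) : ℕ :=
  ∑ i ∈ rightDescents cs w, ((i : ℕ) + 1)

/-- The Gaussian binomial coefficient `[n choose k]_q` as a polynomial in `q = X` over `ℤ`,
defined via the `q`-Pascal recursion `[n+1 choose k+1]_q = [n choose k]_q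
+ q^(k+1) · [n choose k+1]_q`; equivalently, it is the generating polynomial
`Σ_λ q^|λ|` over integer partitions `λ` fitting in a `k × (n-k)` box. -/
noncomputable def qbinom : ℕ → ℕ → Polynomial ℤ
  | _, 0 => 1
  | 0, _ + 1 => 0
  | n + 1, k + 1 => qbinom n k + Polynomial.X ^ (k + 1) * qbinom n (k + 1)

namespace CoxeterSystem

variable {B W : Type*} [Group W] {M : CoxeterMatrix B} (cs : CoxeterSystem M W)

open List

open Classical in
/-- The action of a simple reflection on pairs consisting of a group element and a parity. -/
noncomputable def signedConj (i : B) : Function.End (W × ZMod 2) :=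
  fun p => (cs.simple i * p.1 * cs.simple i, p.2 + if p.1 = cs.simple i then 1 else 0)

open Classical in
theorem prod_map_signedConj (ω : List B) (t : W) (e : ZMod 2) :
    (ω.map cs.signedConj).prod (t, e) =
      (cs.wordProd ω * t * (cs.wordProd ω)⁻¹, e + (cs.rightInvSeq ω).count t) := by
  induction ω with
  | nil => simp [Function.End.one_def]
  | cons i ω ih =>
    rw [List.map_cons, List.prod_cons]
    change cs.signedConj i ((ω.map cs.signedConj).prod (t, e)) = _
    rw [ih]
    simp only [signedConj, wordProd_cons, mul_inv_rev, inv_simple, mul_assoc, rightInvSeq,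
      List.count_cons, Prod.mk.injEq, true_and, Nat.cast_add, add_assoc]
    congr 2
    have : (cs.wordProd ω * (t * (cs.wordProd ω)⁻¹) = cs.simple i) ↔
        ((cs.wordProd ω)⁻¹ * (cs.simple i * cs.wordProd ω) = t) := by
      constructor
      · intro h; rw [← h]; group
      · intro h; rw [← h]; group
    by_cases h : (cs.wordProd ω)⁻¹ * (cs.simple i * cs.wordProd ω) = t
    · simp [this, h]
    · simp [this, h]

theorem alternatingWord_add_two (i j : B) (m : ℕ) :
    alternatingWord i j (m + 2) = alternatingWord i j m ++ [i, j] := by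
  rw [alternatingWord_succ, alternatingWord_succ]
  simp

theorem prod_map_reverse_alternatingWord {G : Type*} [Monoid G] (f : B → G) (i j : B) (m : ℕ) :
    ((alternatingWord j i (2 * m)).reverse.map f).prod = (f i * f j) ^ m := by
  induction m with
  | zero => simp [alternatingWord]
  | succ m ih =>
    rw [Nat.mul_succ, alternatingWord_add_two, List.reverse_append, List.map_append,
      List.prod_append, ih, pow_succ']
    simp

theorem signedConj_isLiftable : M.IsLiftable cs.signedConj := by
  classical
  intro i j
  set m := M i j with hm
  rw [← prod_map_reverse_alternatingWord cs.signedConj i j m]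
  funext ⟨t, e⟩
  rw [prod_map_signedConj]
  have h1 : cs.wordProd (alternatingWord j i (2 * m)).reverse = 1 := by
    rw [wordProd, prod_map_reverse_alternatingWord, hm, simple_mul_simple_pow]
  have h2 : (cs.rightInvSeq (alternatingWord j i (2 * m)).reverse).count t =
      2 * ((cs.leftInvSeq (alternatingWord j i (2 * m))).take m).count t := by
    rw [rightInvSeq_reverse, List.count_reverse]
    set L := cs.leftInvSeq (alternatingWord j i (2 * m)) with hL
    have hlen : L.length = 2 * m := by simp [hL]
    have : L.drop m = L.take m := by
      apply List.ext_getElem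
      · simp [hlen]; omega
      · intro k hk1 hk2
        rw [List.length_take] at hk2
        rw [List.getElem_drop, List.getElem_take]
        simp only [hL]
        rw [getElem_leftInvSeq_alternatingWord _ _ _ _ _ (by omega),
          getElem_leftInvSeq_alternatingWord _ _ _ _ _ (by omega),
          prod_alternatingWord_eq_mul_pow, prod_alternatingWord_eq_mul_pow]
        have e1 : ¬Even (2 * (m + k) + 1) := by simp
        have e2 : ¬Even (2 * k + 1) := by simp
        rw [if_neg e1, if_neg e2, show (2 * (m + k) + 1) / 2 = m + k by omega,
          show (2 * k + 1) / 2 = k by omega, pow_add, hm, simple_mul_simple_pow, one_mul]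
    conv_lhs => rw [← List.take_append_drop m L, List.count_append, this]
    ring
  rw [h1, h2]
  have h3 : (2 : ZMod 2) = 0 := by decide
  simp [h3, Function.End.one_def]

open Classical in
theorem count_rightInvSeq_cast_eq {ω ω' : List B} (h : cs.wordProd ω = cs.wordProd ω') (t : W) :
    ((cs.rightInvSeq ω).count t : ZMod 2) = (cs.rightInvSeq ω').count t := by
  have key : ∀ ω : List B, (ω.map cs.signedConj).prod =
      cs.lift ⟨cs.signedConj, cs.signedConj_isLiftable⟩ (cs.wordProd ω) := by
    intro ω
    rw [wordProd, map_list_prod, List.map_map]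
    congr 2
    funext i
    rw [Function.comp_apply, lift_apply_simple]
  have h1 := cs.prod_map_signedConj ω t 0
  have h2 := cs.prod_map_signedConj ω' t 0
  rw [key] at h1 h2
  rw [← h] at h2
  simpa using congrArg Prod.snd (h1.symm.trans h2)

/-- The exchange property. -/
theorem exists_eraseIdx_of_isRightDescent {ω : List B} {i : B}
    (h : cs.IsRightDescent (cs.wordProd ω) i) :
    ∃ k < ω.length, cs.wordProd ω * cs.simple i = cs.wordProd (ω.eraseIdx k) := by
  classical
  obtain ⟨ω', hω', hprod⟩ := cs.exists_isReduced (cs.wordProd ω * cs.simple i)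
  have h1 : cs.simple i ∉ cs.rightInvSeq ω' := by
    intro hmem
    have := cs.isRightInversion_of_mem_rightInvSeq hω' hmem
    rw [← hprod, isRightInversion_simple_iff_isRightDescent] at this
    exact (cs.isRightDescent_iff_not_isRightDescent_mul.1 h) this
  have h2 : cs.wordProd ω = cs.wordProd (ω'.concat i) := by
    rw [wordProd_concat, ← hprod, simple_mul_simple_cancel_right]
  have h3 := cs.count_rightInvSeq_cast_eq h2 (cs.simple i)
  have h4 : cs.simple i ∈ cs.rightInvSeq ω := by
    by_contra hmem
    rw [List.count_eq_zero_of_not_mem hmem, rightInvSeq_concat, List.concat_eq_append,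
      List.count_append, List.count_eq_zero_of_not_mem] at h3
    · simp at h3
    · intro hm
      obtain ⟨x, hx, hxi⟩ := List.mem_map.1 hm
      apply h1
      have : x = cs.simple i := by
        have := congrArg (fun y => cs.simple i * y * cs.simple i) hxi
        simpa [MulAut.conj_apply, mul_assoc] using this
      exact this ▸ hx
  obtain ⟨k, hk, hki⟩ := List.getElem_of_mem h4
  refine ⟨k, by simpa using hk, ?_⟩
  rw [← wordProd_mul_getD_rightInvSeq, List.getD_eq_getElem _ _ hk, hki]

variable {cs}

theorem IsReduced.of_append_left {u v : List B} (h : cs.IsReduced (u ++ v)) : cs.IsReduced u := by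
  simpa using h.take u.length

theorem IsReduced.of_append_right {u v : List B} (h : cs.IsReduced (u ++ v)) :
    cs.IsReduced v := by
  simpa using h.drop u.length

theorem IsReduced.isChain {u : List B} (h : cs.IsReduced u) : u.IsChain (· ≠ ·) := by
  induction u with
  | nil => simp
  | cons a u ih =>
    cases u with
    | nil => simp
    | cons b v =>
      refine List.isChain_cons_cons.2 ⟨?_, ih (IsReduced.of_append_right (u := [a]) h)⟩
      rintro rfl
      have h1 := h.eq
      have h2 := cs.length_wordProd_le v
      rw [wordProd_cons, wordProd_cons, simple_mul_simple_cancel_left] at h1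
      simp only [List.length_cons] at h1
      omega

theorem eq_alternatingWord_of_isChain {s t : B} {d : List B} (hd : ∀ x ∈ d, x = s ∨ x = t)
    (h : (d ++ [t]).IsChain (· ≠ ·)) : d ++ [t] = alternatingWord s t (d.length + 1) := by
  induction d using List.reverseRecOn generalizing s t with
  | nil => simp [alternatingWord]
  | append_singleton d x ih =>
    have hx : x = s := by
      have h1 : x ≠ t := by
        rw [List.append_assoc] at h
        have := h.right_of_append
        simpa using this
      exact (hd x (by simp)).resolve_right h1
    subst hx
    rw [ih (t := x) (s := t) (fun y hy => (hd y (by simp [hy])).symm) h.left_of_append,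
      length_alternatingWord, alternatingWord_succ x t,
      List.concat_eq_append]

theorem mem_alternatingWord {s t x : B} {k : ℕ} (h : x ∈ alternatingWord s t k) :
    x = s ∨ x = t := by
  induction k generalizing s t with
  | zero => simp [alternatingWord] at h
  | succ k ih =>
    rw [alternatingWord_succ, List.concat_eq_append, List.mem_append, List.mem_singleton] at h
    rcases h with h | h
    · exact (ih h).symm
    · exact Or.inr h

/-- Two simple reflections generate a dihedral group of the expected order. -/
def HasDihedralOrders (cs : CoxeterSystem M W) : Prop :=
  ∀ s t, s ≠ t → M s t ≠ 0 ∧ ∀ k, 0 < k → k < M s t →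
    cs.wordProd (alternatingWord s t k) ≠ cs.wordProd (alternatingWord t s k)

theorem exists_isReduced_append_alternatingWord (H : cs.HasDihedralOrders) {w : W} {s t : B}
    (hst : s ≠ t) (hs : cs.IsRightDescent w s) (ht : cs.IsRightDescent w t) (k : ℕ)
    (hk : k ≤ M s t) :
    ∃ x, cs.IsReduced (x ++ alternatingWord s t k) ∧
      cs.wordProd (x ++ alternatingWord s t k) = w := by
  induction k generalizing s t with
  | zero =>
    obtain ⟨ω, h1, h2⟩ := cs.exists_isReduced w
    exact ⟨ω, by simpa [alternatingWord] using h1, by simp [alternatingWord, h2]⟩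
  | succ k ih =>
    rw [M.symmetric] at hk
    obtain ⟨x, hred, hprod⟩ := ih hst.symm ht hs (by omega)
    have hlen : cs.length w = x.length + k := by
      rw [← hprod, hred.eq]; simp
    rw [← hprod] at ht
    obtain ⟨p, hp, hpe⟩ := cs.exists_eraseIdx_of_isRightDescent ht
    rw [hprod] at hpe
    simp only [List.length_append, length_alternatingWord] at hp
    rcases lt_or_ge p x.length with hpx | hpx
    · rw [List.eraseIdx_append_of_lt_length hpx] at hpe
      have hprod' : cs.wordProd (x.eraseIdx p ++ alternatingWord s t (k + 1)) = w := by
        rw [alternatingWord_succ, List.concat_eq_append, ← List.append_assoc, wordProd_append,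
          ← hpe]
        simp
      refine ⟨x.eraseIdx p, ?_, hprod'⟩
      rw [IsReduced, hprod', hlen]
      simp [List.length_eraseIdx, hpx]
      omega
    · exfalso
      rw [List.eraseIdx_append_of_length_le hpx] at hpe
      set d := (alternatingWord t s k).eraseIdx (p - x.length) with hd
      have hdl : d.length + 1 = k := by
        rw [hd, List.length_eraseIdx, length_alternatingWord, if_pos (by omega)]
        omega
      have hprod' : cs.wordProd (x ++ (d ++ [t])) = w := by
        rw [← List.append_assoc, wordProd_append, ← hpe]
        simp
      have hred' : cs.IsReduced (x ++ (d ++ [t])) := by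
        rw [IsReduced, hprod', hlen, ← hdl]
        simp
      have halt := eq_alternatingWord_of_isChain (s := s) (t := t) (d := d)
        (fun y hy => (mem_alternatingWord (List.mem_of_mem_eraseIdx hy)).symm)
        hred'.of_append_right.isChain
      rw [halt, hdl, ← hprod, wordProd_append, wordProd_append, mul_right_inj] at hprod'
      exact (H s t hst).2 k (by omega) (by rw [M.symmetric]; omega) hprod'

end CoxeterSystem

namespace CommEquiv

variable {B : Type*} {M : CoxeterMatrix B}

theorem refl (u : List B) : CommEquiv M u u := Relation.EqvGen.refl u

theorem symm {u v : List B} (h : CommEquiv M u v) : CommEquiv M v u := Relation.EqvGen.symm _ _ h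

theorem trans {u v w : List B} (h : CommEquiv M u v) (h' : CommEquiv M v w) : CommEquiv M u w :=
  Relation.EqvGen.trans _ _ _ h h'

theorem swap {a b : B} (h : M a b = 2) (u v : List B) :
    CommEquiv M (u ++ a :: b :: v) (u ++ b :: a :: v) :=
  Relation.EqvGen.rel _ _ ⟨u, v, a, b, h, rfl, rfl⟩

theorem append {u v : List B} (h : CommEquiv M u v) (x y : List B) :
    CommEquiv M (x ++ u ++ y) (x ++ v ++ y) := by
  induction h with
  | rel u v h =>
    obtain ⟨p, q, a, b, hab, rfl, rfl⟩ := h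
    simpa using swap hab (x ++ p) (q ++ y)
  | refl u => exact refl _
  | symm u v _ ih => exact ih.symm
  | trans u v w _ _ ih ih' => exact ih.trans ih'

theorem append_right {u v : List B} (h : CommEquiv M u v) (y : List B) :
    CommEquiv M (u ++ y) (v ++ y) := by simpa using h.append [] y

theorem append_left {u v : List B} (h : CommEquiv M u v) (x : List B) :
    CommEquiv M (x ++ u) (x ++ v) := by simpa using h.append x []

theorem perm {u v : List B} (h : CommEquiv M u v) : u.Perm v := by
  induction h with
  | rel u v h =>
    obtain ⟨p, q, a, b, hab, rfl, rfl⟩ := h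
    exact (List.Perm.swap _ _ _).append_left p
  | refl u => exact List.Perm.refl _
  | symm u v _ ih => exact ih.symm
  | trans u v w _ _ ih ih' => exact ih.trans ih'

theorem wordProd_eq {W : Type*} [Group W] (cs : CoxeterSystem M W) {u v : List B}
    (h : CommEquiv M u v) : cs.wordProd u = cs.wordProd v := by
  induction h with
  | rel u v h =>
    obtain ⟨p, q, a, b, hab, rfl, rfl⟩ := h
    have h1 := cs.wordProd_braidWord_eq a b
    rw [CoxeterSystem.braidWord, CoxeterSystem.braidWord, M.symmetric b a, hab] at h1
    simp only [CoxeterSystem.alternatingWord, List.concat_eq_append, List.nil_append,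
      List.cons_append, CoxeterSystem.wordProd_cons, CoxeterSystem.wordProd_nil, mul_one] at h1
    simp only [CoxeterSystem.wordProd_append, CoxeterSystem.wordProd_cons, ← mul_assoc,
      mul_left_inj]
    simp only [mul_assoc, h1]
  | refl u => rfl
  | symm u v _ ih => exact ih.symm
  | trans u v w _ _ ih ih' => exact ih.trans ih'

theorem isReduced {W : Type*} [Group W] {cs : CoxeterSystem M W} {u v : List B}
    (h : CommEquiv M u v) (hu : cs.IsReduced u) : cs.IsReduced v := by
  rw [CoxeterSystem.IsReduced, ← h.wordProd_eq cs, ← h.perm.length_eq]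
  exact hu

theorem move_head {s : B} {y : List B} (hy : ∀ b ∈ y, M s b = 2) (z : List B) :
    CommEquiv M (y ++ s :: z) (s :: y ++ z) := by
  induction y with
  | nil => exact refl _
  | cons b y ih =>
    have h1 := (ih fun c hc => hy c (by simp [hc])).append_left [b]
    have h2 := (swap (hy b (by simp)) [] (y ++ z)).symm
    exact h1.trans h2

variable [DecidableEq B]

theorem filter_eq {u v : List B} (h : CommEquiv M u v) {c d : B} (hcd : M c d ≠ 2) :
    u.filter (fun x => x = c ∨ x = d) = v.filter (fun x => x = c ∨ x = d) := by
  induction h with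
  | rel u v h =>
    obtain ⟨p, q, a, b, hab, rfl, rfl⟩ := h
    have hne : a ≠ b := by
      rintro rfl
      simp at hab
    have : ¬((a = c ∨ a = d) ∧ (b = c ∨ b = d)) := by
      rintro ⟨rfl | rfl, rfl | rfl⟩
      · exact hne rfl
      · exact hcd hab
      · rw [M.symmetric] at hab
        exact hcd hab
      · exact hne rfl
    simp only [List.filter_append, List.filter_cons]
    by_cases h1 : a = c ∨ a = d <;> by_cases h2 : b = c ∨ b = d <;> simp_all
  | refl u => rfl
  | symm u v _ ih => exact ih.symm
  | trans u v w _ _ ih ih' => exact ih.trans ih'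

/-- A letter that comes first in each projection to a non-commuting pair can be moved to the
front. -/
theorem exists_cons {s : B} {u : List B}
    (h : ∀ b, M s b ≠ 2 → (u.filter (fun x => x = s ∨ x = b)).head? = some s) :
    ∃ v, CommEquiv M u (s :: v) := by
  have hs : s ∈ u := by
    have := List.mem_of_head? (h s (by simp))
    exact (List.mem_filter.1 this).1
  obtain ⟨y, z, rfl, hsy⟩ := List.eq_append_cons_of_mem hs
  refine ⟨y ++ z, move_head (fun b hb => ?_) z⟩
  by_contra hM
  have h1 := h b hM
  have hb' : b ∈ y.filter (fun x => x = s ∨ x = b) := by simp [hb]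
  rw [List.filter_append, List.head?_append_of_ne_nil _ (List.ne_nil_of_mem hb')] at h1
  exact hsy (List.mem_filter.1 (List.mem_of_head? h1)).1

/-- Two words are commutation equivalent as soon as they have the same projections to all pairs
of non-commuting letters. -/
theorem of_filter_eq {u v : List B} (h : ∀ c d, M c d ≠ 2 →
    u.filter (fun x => x = c ∨ x = d) = v.filter (fun x => x = c ∨ x = d)) :
    CommEquiv M u v := by
  induction u generalizing v with
  | nil =>
    cases v with
    | nil => exact refl _
    | cons a v => simpa using h a a (by simp)
  | cons a u ih =>
    obtain ⟨v', hv⟩ := exists_cons (M := M) (s := a) (u := v) fun b hb => by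
      rw [← h a b hb]; simp
    refine ((ih fun c d hcd => ?_).append_left [a]).trans hv.symm
    have h1 := (h c d hcd).trans (hv.filter_eq hcd)
    by_cases hac : a = c ∨ a = d
    · simpa [List.filter_cons, hac] using h1
    · simpa [List.filter_cons, hac] using h1

theorem reverse {u v : List B} (h : CommEquiv M u v) : CommEquiv M u.reverse v.reverse :=
  of_filter_eq fun c d hcd => by
    rw [List.filter_reverse, List.filter_reverse, h.filter_eq hcd]

theorem exists_append_singleton_iff {s : B} {u : List B} :
    (∃ v, CommEquiv M u (v ++ [s])) ↔
      ∀ b, M s b ≠ 2 → (u.filter (fun x => x = s ∨ x = b)).getLast? = some s := by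
  constructor
  · rintro ⟨v, hv⟩ b hb
    rw [hv.filter_eq hb]
    simp
  · intro h
    obtain ⟨v, hv⟩ := exists_cons (M := M) (s := s) (u := u.reverse) fun b hb => by
      rw [List.filter_reverse, List.head?_reverse, h b hb]
    exact ⟨v.reverse, by simpa using hv.reverse⟩

end CommEquiv

/-- No word commutation equivalent to `u` contains a square or a long braid word. -/
def AvoidsBraids {B : Type*} (M : CoxeterMatrix B) (u : List B) : Prop :=
  ∀ v, CommEquiv M u v → (∀ a, ¬[a, a] <:+: v) ∧
    ∀ a b, 3 ≤ M a b → ¬alternatingWord a b (M a b) <:+: v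

namespace AvoidsBraids

variable {B W : Type*} [Group W] {M : CoxeterMatrix B} {cs : CoxeterSystem M W}

theorem congr {u v : List B} (h : AvoidsBraids M u) (huv : CommEquiv M u v) : AvoidsBraids M v :=
  fun w hw => h w (huv.trans hw)

theorem of_append_left {u v : List B} (h : AvoidsBraids M (u ++ v)) : AvoidsBraids M u := by
  intro w hw
  have h1 := h _ (hw.append_right v)
  refine ⟨fun a ha => h1.1 a (ha.trans (List.infix_append_left ..)), fun a b hab ha =>
    h1.2 a b hab (ha.trans (List.infix_append_left ..))⟩

theorem main (H : cs.HasDihedralOrders) (k : ℕ) (u : List B) (hk : u.length = k)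
    (hu : AvoidsBraids M u) :
    cs.IsReduced u ∧
      (∀ s, cs.IsRightDescent (cs.wordProd u) s → ∃ v, CommEquiv M u (v ++ [s])) ∧
      ∀ v, cs.IsReduced v → cs.wordProd v = cs.wordProd u → CommEquiv M u v := by
  classical
  induction k generalizing u with
  | zero =>
    obtain rfl := List.length_eq_zero_iff.1 hk
    refine ⟨by simp [CoxeterSystem.IsReduced], fun s hs => ?_, fun v hv hvw => ?_⟩
    · exact absurd hs (by simp [CoxeterSystem.IsRightDescent])
    · have h1 := hv.eq
      rw [hvw] at h1
      simp only [CoxeterSystem.wordProd_nil, CoxeterSystem.length_one] at h1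
      rw [List.length_eq_zero_iff.1 h1.symm]
      exact CommEquiv.refl _
  | succ k ih =>
    rcases List.eq_nil_or_concat' u with rfl | ⟨u', t, rfl⟩
    · simp at hk
    have hk' : u'.length = k := by simpa using hk
    obtain ⟨ihr, ihd, ihc⟩ := ih u' hk' hu.of_append_left
    have hred : cs.IsReduced (u' ++ [t]) := by
      by_contra hcon
      have hdes : cs.IsRightDescent (cs.wordProd u') t := by
        by_contra hnd
        rw [cs.not_isRightDescent_iff, ihr.eq] at hnd
        apply hcon
        rw [CoxeterSystem.IsReduced, cs.wordProd_append, cs.wordProd_singleton, hnd]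
        simp
      obtain ⟨u'', hu''⟩ := ihd t hdes
      refine (hu _ (hu''.append_right [t])).1 t ⟨u'', [], by simp⟩
    have hdesc : ∀ s, cs.IsRightDescent (cs.wordProd (u' ++ [t])) s →
        ∃ v, CommEquiv M (u' ++ [t]) (v ++ [s]) := by
      intro s hs
      by_cases hst : s = t
      · subst hst
        exact ⟨u', CommEquiv.refl _⟩
      have ht : cs.IsRightDescent (cs.wordProd (u' ++ [t])) t := by
        rw [CoxeterSystem.IsRightDescent, hred.eq, cs.wordProd_append, cs.wordProd_singleton,
          cs.simple_mul_simple_cancel_right, ihr.eq]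
        simp
      obtain ⟨x, hx, hxw⟩ :=
        CoxeterSystem.exists_isReduced_append_alternatingWord H hst hs ht (M s t) le_rfl
      obtain ⟨m, hm⟩ : ∃ m, M s t = m + 2 := by
        have h1 := (H s t hst).1
        have h2 := M.off_diagonal s t hst
        exact ⟨M s t - 2, by omega⟩
      have halt : x ++ alternatingWord s t (M s t) =
          (x ++ alternatingWord t s (m + 1)) ++ [t] := by
        rw [hm, alternatingWord_succ, List.concat_eq_append, List.append_assoc]
      rw [halt] at hx hxw
      rw [cs.wordProd_append _ [t], cs.wordProd_append _ [t], mul_left_inj] at hxw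
      have hequiv := (ihc _ hx.of_append_left hxw).append_right [t]
      rcases Nat.eq_zero_or_pos m with rfl | hmpos
      · refine ⟨x ++ [t], hequiv.trans ?_⟩
        have h2 : M t s = 2 := by rw [M.symmetric, hm]
        simpa [alternatingWord] using (CommEquiv.swap h2 x []).symm
      · exfalso
        rw [← halt] at hequiv
        exact (hu _ hequiv).2 s t (by omega) ⟨x, [], by simp⟩
    refine ⟨hred, hdesc, fun v hv hvw => ?_⟩
    have hvl : v.length = k + 1 := by rw [← hv.eq, hvw, hred.eq, hk]
    rcases List.eq_nil_or_concat' v with rfl | ⟨v', s, rfl⟩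
    · simp at hvl
    have hs : cs.IsRightDescent (cs.wordProd (v' ++ [s])) s := by
      rw [CoxeterSystem.IsRightDescent, hv.eq, cs.wordProd_append, cs.wordProd_singleton,
        cs.simple_mul_simple_cancel_right, hv.of_append_left.eq]
      simp
    rw [hvw] at hs
    obtain ⟨u'', hu''⟩ := hdesc s hs
    have hl : u''.length = k := by
      have := hu''.perm.length_eq
      rw [hk] at this
      simpa using this.symm
    have hp := hvw.trans (hu''.wordProd_eq cs)
    rw [cs.wordProd_append _ [s], cs.wordProd_append _ [s], mul_left_inj] at hp
    exact hu''.trans (((ih u'' hl (hu.congr hu'').of_append_left).2.2 v' hv.of_append_left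
      hp).append_right [s])

theorem isReduced (H : cs.HasDihedralOrders) {u : List B} (hu : AvoidsBraids M u) :
    cs.IsReduced u := (main H _ u rfl hu).1

theorem commEquiv (H : cs.HasDihedralOrders) {u v : List B} (hu : AvoidsBraids M u)
    (hv : cs.IsReduced v) (h : cs.wordProd v = cs.wordProd u) : CommEquiv M u v :=
  (main H _ u rfl hu).2.2 v hv h

theorem isRightDescent_iff (H : cs.HasDihedralOrders) {u : List B} (hu : AvoidsBraids M u)
    (s : B) : cs.IsRightDescent (cs.wordProd u) s ↔ ∃ v, CommEquiv M u (v ++ [s]) := by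
  refine ⟨(main H _ u rfl hu).2.1 s, ?_⟩
  rintro ⟨v, hv⟩
  have h1 := hv.isReduced (isReduced H hu)
  rw [CoxeterSystem.IsRightDescent, hv.wordProd_eq cs, h1.eq, cs.wordProd_append,
    cs.wordProd_singleton, cs.simple_mul_simple_cancel_right, h1.of_append_left.eq]
  simp

theorem isFullyCommutative (H : cs.HasDihedralOrders) {u : List B} (hu : AvoidsBraids M u) :
    IsFullyCommutative cs (cs.wordProd u) := fun _ _ ha ha' hb hb' =>
  (commEquiv H hu ha ha').symm.trans (commEquiv H hu hb hb')

end AvoidsBraids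

section

variable {B W : Type*} [Group W] {M : CoxeterMatrix B} {cs : CoxeterSystem M W}

theorem IsFullyCommutative.avoidsBraids {u : List B}
    (h : IsFullyCommutative cs (cs.wordProd u)) (hu : cs.IsReduced u) : AvoidsBraids M u := by
  classical
  intro v hv
  have hvr := hv.isReduced hu
  constructor
  · rintro a ⟨x, y, rfl⟩
    have := (hvr.of_append_left).of_append_right.isChain
    simp at this
  · rintro a b hab ⟨x, y, rfl⟩
    have hba : M b a = M a b := M.symmetric b a
    have hprod : cs.wordProd (x ++ alternatingWord b a (M a b) ++ y) =
        cs.wordProd (x ++ alternatingWord a b (M a b) ++ y) := by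
      have := cs.wordProd_braidWord_eq a b
      rw [braidWord, braidWord, hba] at this
      simp only [cs.wordProd_append, this]
    have hred : cs.IsReduced (x ++ alternatingWord b a (M a b) ++ y) := by
      rw [CoxeterSystem.IsReduced, hprod, hvr.eq]
      simp
    have h1 := h _ _ hvr (hv.wordProd_eq cs).symm hred (hprod.trans (hv.wordProd_eq cs).symm)
    have h2 := h1.filter_eq (c := a) (d := b) (by omega)
    simp only [List.filter_append, List.append_cancel_right_eq,
      List.append_cancel_left_eq] at h2
    have h3 : ∀ c d, (∀ z, z = c ∨ z = d → z = a ∨ z = b) →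
        (alternatingWord c d (M a b)).filter (fun x => x = a ∨ x = b) =
          alternatingWord c d (M a b) := by
      intro c d hcd
      rw [List.filter_eq_self]
      intro z hz
      simpa using hcd z (CoxeterSystem.mem_alternatingWord hz)
    rw [h3 a b (fun _ => id), h3 b a (fun _ => Or.symm)] at h2
    obtain ⟨m, hm⟩ : ∃ m, M a b = m + 1 := ⟨M a b - 1, by omega⟩
    rw [hm, alternatingWord_succ, alternatingWord_succ, List.concat_eq_append,
      List.concat_eq_append] at h2
    have h4 := (List.append_inj' h2 rfl).2
    obtain rfl : b = a := by simpa using h4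
    simp at hab

theorem AvoidsBraids.isFCInvolution_iff (H : cs.HasDihedralOrders) {u : List B}
    (hu : AvoidsBraids M u) :
    IsFCInvolution cs (cs.wordProd u) ↔ CommEquiv M u u.reverse := by
  have hred := hu.isReduced H
  have key : cs.wordProd u * cs.wordProd u = 1 ↔ cs.wordProd u.reverse = cs.wordProd u := by
    rw [cs.wordProd_reverse, ← mul_eq_one_iff_inv_eq]
  rw [IsFCInvolution, key]
  constructor
  · rintro ⟨-, h⟩
    refine hu.commEquiv H ?_ h
    rw [CoxeterSystem.isReduced_reverse_iff]
    exact hred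
  · intro h
    exact ⟨hu.isFullyCommutative H, (h.wordProd_eq cs).symm⟩

end

theorem typeB_apply {n : ℕ} (i j : Fin n) : typeB n i j =
    if (i : ℕ) = (j : ℕ) then 1
    else if (i : ℕ) + 1 = (j : ℕ) ∨ (j : ℕ) + 1 = (i : ℕ) then
      (if (i : ℕ) + 1 = n ∨ (j : ℕ) + 1 = n then 4 else 3)
    else 2 := rfl

/-- The action of the generators of type `B_n` on signed indices. -/
def signedIndexAction (n k : ℕ) : Function.End (ℕ × Bool) := fun p =>
  if k + 1 = n then (p.1, if p.1 = k then !p.2 else p.2)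
  else (if p.1 = k then k + 1 else if p.1 = k + 1 then k else p.1, p.2)

theorem signedIndexAction_apply_last {n k : ℕ} (h : k + 1 = n) (x : ℕ) (b : Bool) :
    signedIndexAction n k (x, b) = (x, if x = k then !b else b) := by
  simp [signedIndexAction, h]

theorem signedIndexAction_apply_of_ne {n k : ℕ} (h : k + 1 ≠ n) (x : ℕ) (b : Bool) :
    signedIndexAction n k (x, b) = (if x = k then k + 1 else if x = k + 1 then k else x, b) := by
  simp [signedIndexAction, h]

theorem signedIndexAction_mul_self (n k : ℕ) :
    signedIndexAction n k * signedIndexAction n k = 1 := by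
  funext ⟨x, b⟩
  change signedIndexAction n k (signedIndexAction n k (x, b)) = (x, b)
  cases b <;> grind [signedIndexAction_apply_last, signedIndexAction_apply_of_ne]

theorem signedIndexAction_commute (n i j : ℕ) (h : i + 2 ≤ j) (hj : j < n) :
    signedIndexAction n i * signedIndexAction n j =
      signedIndexAction n j * signedIndexAction n i := by
  funext ⟨x, b⟩
  change signedIndexAction n i (signedIndexAction n j (x, b)) =
    signedIndexAction n j (signedIndexAction n i (x, b))
  cases b <;> grind [signedIndexAction_apply_last, signedIndexAction_apply_of_ne]

theorem signedIndexAction_braid (n i : ℕ) (h : i + 2 < n) :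
    signedIndexAction n i * signedIndexAction n (i + 1) * signedIndexAction n i =
      signedIndexAction n (i + 1) * signedIndexAction n i * signedIndexAction n (i + 1) := by
  funext ⟨x, b⟩
  change signedIndexAction n i (signedIndexAction n (i + 1) (signedIndexAction n i (x, b))) =
    signedIndexAction n (i + 1) (signedIndexAction n i (signedIndexAction n (i + 1) (x, b)))
  have h1 : i + 1 ≠ n := by omega
  have h2 : i + 1 + 1 ≠ n := by omega
  cases b <;> grind [signedIndexAction_apply_last, signedIndexAction_apply_of_ne]

theorem signedIndexAction_braid_last (n i : ℕ) (h : i + 2 = n) :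
    signedIndexAction n i * signedIndexAction n (i + 1) * signedIndexAction n i *
      signedIndexAction n (i + 1) =
    signedIndexAction n (i + 1) * signedIndexAction n i * signedIndexAction n (i + 1) *
      signedIndexAction n i := by
  funext ⟨x, b⟩
  change signedIndexAction n i (signedIndexAction n (i + 1) (signedIndexAction n i
      (signedIndexAction n (i + 1) (x, b)))) =
    signedIndexAction n (i + 1) (signedIndexAction n i (signedIndexAction n (i + 1)
      (signedIndexAction n i (x, b))))
  have h1 : i + 1 ≠ n := by omega
  have h2 : i + 1 + 1 = n := by omega
  cases b <;> grind [signedIndexAction_apply_last, signedIndexAction_apply_of_ne]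

theorem mul_pow_two_eq_one {G : Type*} [Monoid G] {a b : G} (ha : a * a = 1) (hb : b * b = 1)
    (h : a * b = b * a) : (a * b) ^ 2 = 1 := by
  calc (a * b) ^ 2 = a * b * (a * b) := sq _
    _ = a * b * (b * a) := by rw [h]
    _ = a * (b * b) * a := by simp only [mul_assoc]
    _ = 1 := by rw [hb, mul_one, ha]

theorem mul_pow_three_eq_one {G : Type*} [Monoid G] {a b : G} (ha : a * a = 1) (hb : b * b = 1)
    (h : a * b * a = b * a * b) : (a * b) ^ 3 = 1 := by
  calc (a * b) ^ 3 = (a * b * a) * (b * a * b) := by simp only [pow_succ, pow_zero, one_mul, mul_assoc]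
    _ = (a * b * a) * (a * b * a) := by rw [h]
    _ = a * (b * (a * a) * b) * a := by simp only [mul_assoc]
    _ = 1 := by rw [ha, mul_one, hb, mul_one, ha]

theorem mul_pow_four_eq_one {G : Type*} [Monoid G] {a b : G} (ha : a * a = 1) (hb : b * b = 1)
    (h : a * b * a * b = b * a * b * a) : (a * b) ^ 4 = 1 := by
  calc (a * b) ^ 4 = (a * b * a * b) * (a * b * a * b) := by
        simp only [pow_succ, pow_zero, one_mul, mul_assoc]
    _ = (a * b * a * b) * (b * a * b * a) := by rw [h]
    _ = a * (b * (a * (b * b) * a) * b) * a := by simp only [mul_assoc]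
    _ = 1 := by rw [hb, mul_one, ha, mul_one, hb, mul_one, ha]

theorem signedIndexAction_isLiftable (n : ℕ) :
    (typeB n).IsLiftable fun i : Fin n => signedIndexAction n i := by
  rintro ⟨i, hi⟩ ⟨j, hj⟩
  change (signedIndexAction n i * signedIndexAction n j) ^ _ = 1
  rw [typeB_apply]
  simp only
  have sq := signedIndexAction_mul_self n
  split_ifs with h1 h2 h3
  · subst h1
    rw [sq, one_pow]
  · refine mul_pow_four_eq_one (sq i) (sq j) ?_
    rcases h2 with rfl | rfl
    · exact signedIndexAction_braid_last n i (by omega)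
    · exact (signedIndexAction_braid_last n j (by omega)).symm
  · refine mul_pow_three_eq_one (sq i) (sq j) ?_
    rcases h2 with rfl | rfl
    · exact signedIndexAction_braid n i (by omega)
    · exact (signedIndexAction_braid n j (by omega)).symm
  · refine mul_pow_two_eq_one (sq i) (sq j) ?_
    rcases lt_or_ge i j with h | h
    · exact signedIndexAction_commute n i j (by omega) hj
    · exact (signedIndexAction_commute n j i (by omega) hi).symm

theorem prod_signedIndexAction_eq {n : ℕ} {W : Type*} [Group W]
    (cs : CoxeterSystem (typeB n) W) {u v : List (Fin n)} (h : cs.wordProd u = cs.wordProd v) :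
    (u.map fun i : Fin n => signedIndexAction n i).prod =
      (v.map fun i : Fin n => signedIndexAction n i).prod := by
  have key : ∀ w : List (Fin n), (w.map fun i : Fin n => signedIndexAction n i).prod =
      cs.lift ⟨_, signedIndexAction_isLiftable n⟩ (cs.wordProd w) := by
    intro w
    rw [wordProd, map_list_prod, List.map_map]
    congr 2
    funext i
    rw [Function.comp_apply, lift_apply_simple]
  rw [key, key, h]

theorem hasDihedralOrders_typeB {n : ℕ} {W : Type*} [Group W]
    (cs : CoxeterSystem (typeB n) W) : cs.HasDihedralOrders := by
  have main : ∀ s t : Fin n, s < t → ∀ k, 0 < k → k < typeB n s t →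
      cs.wordProd (alternatingWord s t k) ≠ cs.wordProd (alternatingWord t s k) := by
    rintro ⟨s, hs⟩ ⟨t, ht⟩ hst k hk hkM heq
    have hst' : s < t := hst
    have h1 := congrFun (prod_signedIndexAction_eq cs heq) (s, true)
    rw [typeB_apply] at hkM
    simp only at hkM
    have h4 : k < 4 := by split_ifs at hkM <;> omega
    interval_cases k
    · change signedIndexAction n t (s, true) = signedIndexAction n s (s, true) at h1
      simp [signedIndexAction] at h1
      grind
    · change signedIndexAction n s (signedIndexAction n t (s, true)) =
        signedIndexAction n t (signedIndexAction n s (s, true)) at h1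
      simp [signedIndexAction] at h1
      grind
    · change signedIndexAction n t (signedIndexAction n s (signedIndexAction n t (s, true))) =
        signedIndexAction n s (signedIndexAction n t (signedIndexAction n s (s, true))) at h1
      have h5 : s + 1 = t ∧ t + 1 = n := by split_ifs at hkM <;> omega
      obtain ⟨rfl, rfl⟩ := h5
      simp [signedIndexAction] at h1
  intro s t hst
  refine ⟨?_, ?_⟩
  · rw [typeB_apply]
    split_ifs <;> omega
  rcases lt_or_gt_of_ne hst with h | h
  · exact main s t h
  · intro k hk hkM
    rw [(typeB n).symmetric] at hkM
    exact (main t s h k hk hkM).symm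

/-- The subword formed by the letters `i` and `i + 1`. -/
def adjProj (i : ℕ) (U : List ℕ) : List ℕ := U.filter fun x => x = i ∨ x = i + 1

@[simp]
theorem adjProj_append (i : ℕ) (U V : List ℕ) : adjProj i (U ++ V) = adjProj i U ++ adjProj i V :=
  List.filter_append ..

@[simp]
theorem adjProj_nil (i : ℕ) : adjProj i [] = [] := rfl

theorem adjProj_cons (i a : ℕ) (U : List ℕ) :
    adjProj i (a :: U) = if a = i ∨ a = i + 1 then a :: adjProj i U else adjProj i U := by
  simp [adjProj, List.filter_cons]

theorem mem_adjProj {i a : ℕ} {U : List ℕ} :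
    a ∈ adjProj i U ↔ a ∈ U ∧ (a = i ∨ a = i + 1) := by simp [adjProj]

theorem adjProj_reverse (i : ℕ) (U : List ℕ) : adjProj i U.reverse = (adjProj i U).reverse :=
  List.filter_reverse ..

theorem adjProj_eq_nil_iff {i : ℕ} {U : List ℕ} : adjProj i U = [] ↔ i ∉ U ∧ i + 1 ∉ U := by
  simp only [adjProj, List.filter_eq_nil_iff, decide_eq_true_eq]
  grind

theorem count_adjProj_self (i : ℕ) (U : List ℕ) : (adjProj i U).count i = U.count i :=
  List.count_filter (by simp)

theorem count_adjProj_succ (i : ℕ) (U : List ℕ) :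
    (adjProj i U).count (i + 1) = U.count (i + 1) :=
  List.count_filter (by simp)

/-- Two words over the natural numbers have the same projections to adjacent letters. -/
def TraceEq (U V : List ℕ) : Prop := ∀ i, adjProj i U = adjProj i V

namespace TraceEq

theorem refl (U : List ℕ) : TraceEq U U := fun _ => rfl

theorem symm {U V : List ℕ} (h : TraceEq U V) : TraceEq V U := fun i => (h i).symm

theorem trans {U V W : List ℕ} (h : TraceEq U V) (h' : TraceEq V W) : TraceEq U W :=
  fun i => (h i).trans (h' i)

theorem append {U V U' V' : List ℕ} (h : TraceEq U V) (h' : TraceEq U' V') :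
    TraceEq (U ++ U') (V ++ V') := fun i => by rw [adjProj_append, adjProj_append, h i, h' i]

theorem reverse {U V : List ℕ} (h : TraceEq U V) : TraceEq U.reverse V.reverse :=
  fun i => by rw [adjProj_reverse, adjProj_reverse, h i]

theorem mem_iff {U V : List ℕ} (h : TraceEq U V) (a : ℕ) : a ∈ U ↔ a ∈ V := by
  have h1 : ∀ W : List ℕ, a ∈ W ↔ a ∈ adjProj a W := fun W => by simp [mem_adjProj]
  rw [h1 U, h1 V, h a]

theorem move {a : ℕ} {y : List ℕ} (h : ∀ b ∈ y, b ≠ a ∧ b ≠ a + 1 ∧ b + 1 ≠ a) :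
    TraceEq (a :: y) (y ++ [a]) := by
  intro i
  rw [adjProj_append, adjProj_cons, adjProj_cons, adjProj_nil]
  split_ifs with h1
  · have : adjProj i y = [] := by
      rw [adjProj_eq_nil_iff]
      constructor <;> intro hm <;> have := h _ hm <;> omega
    rw [this]
    rfl
  · simp

end TraceEq

theorem map_val_filter {n : ℕ} (u : List (Fin n)) (p : ℕ → Bool) :
    (u.map Fin.val).filter p = (u.filter fun x : Fin n => p x.val).map Fin.val := by
  rw [List.filter_map]
  rfl

theorem commEquiv_typeB_iff {n : ℕ} {u v : List (Fin n)} :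
    CommEquiv (typeB n) u v ↔ TraceEq (u.map Fin.val) (v.map Fin.val) := by
  have key : ∀ (w : List (Fin n)) (c d : Fin n), (w.filter fun x => x = c ∨ x = d).map Fin.val =
      (w.map Fin.val).filter fun x => x = c.val ∨ x = d.val := by
    intro w c d
    rw [map_val_filter]
    simp only [Fin.val_inj]
  constructor
  · intro h i
    rcases lt_trichotomy (i + 1) n with h1 | h1 | h1
    · have h2 := h.filter_eq (c := ⟨i, by omega⟩) (d := ⟨i + 1, h1⟩) (by
        simp only [typeB_apply]; grind)
      have h3 := congrArg (List.map Fin.val) h2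
      rwa [key, key] at h3
    · have h2 := h.filter_eq (c := ⟨i, by omega⟩) (d := ⟨i, by omega⟩) (by simp)
      have h3 := congrArg (List.map Fin.val) h2
      rw [key, key] at h3
      have h4 : ∀ w : List (Fin n), adjProj i (w.map Fin.val) =
          (w.map Fin.val).filter fun x => x = i ∨ x = i := by
        intro w
        apply List.filter_congr
        intro x hx
        obtain ⟨a, -, rfl⟩ := List.mem_map.1 hx
        have := a.2
        simp only [decide_eq_decide]
        omega
      rw [h4, h4]
      exact h3
    · have h4 : ∀ w : List (Fin n), adjProj i (w.map Fin.val) = [] := by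
        intro w
        rw [adjProj_eq_nil_iff]
        constructor <;> intro hm <;> obtain ⟨a, -, ha⟩ := List.mem_map.1 hm <;>
          have := a.2 <;> omega
      rw [h4, h4]
  · intro h
    apply CommEquiv.of_filter_eq
    intro c d hcd
    apply List.map_injective_iff.2 Fin.val_injective
    rw [key, key]
    have h1 : (c : ℕ) = d ∨ (c : ℕ) + 1 = d ∨ (d : ℕ) + 1 = c := by
      rw [typeB_apply] at hcd
      split_ifs at hcd <;> simp_all
    rcases h1 with h1 | h1 | h1
    · have h2 := congrArg (List.filter fun x => x = c.val) (h c)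
      simp only [adjProj, List.filter_filter] at h2
      convert h2 using 2 <;> funext x <;> simp [← h1] <;> omega
    · rw [← h1]
      exact h c
    · rw [← h1]
      have := h d
      unfold adjProj at this
      simpa only [or_comm] using this

theorem isRightDescent_iff_getLast? {n : ℕ} {W : Type*} [Group W]
    {cs : CoxeterSystem (typeB n) W} {u : List (Fin n)} (hu : AvoidsBraids (typeB n) u)
    (s : Fin n) : cs.IsRightDescent (cs.wordProd u) s ↔
      (adjProj s (u.map Fin.val)).getLast? = some s.val ∧
        ∀ i, i + 1 = s.val → (adjProj i (u.map Fin.val)).getLast? = some s.val := by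
  rw [hu.isRightDescent_iff (hasDihedralOrders_typeB cs)]
  constructor
  · rintro ⟨v, hv⟩
    rw [commEquiv_typeB_iff] at hv
    constructor
    · rw [hv]
      simp [adjProj_cons]
    · rintro i hi
      rw [hv]
      simp [adjProj_cons, hi]
  · rintro ⟨h1, h2⟩
    rw [CommEquiv.exists_append_singleton_iff]
    intro b hb
    have hinj := Option.map_injective (Fin.val_injective (n := n))
    apply hinj
    rw [← List.getLast?_map, Option.map_some]
    have key : (u.filter fun x => x = s ∨ x = b).map Fin.val =
        (u.map Fin.val).filter fun x => x = s.val ∨ x = b.val := by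
      rw [map_val_filter]
      simp only [Fin.val_inj]
    rw [key]
    have h3 : (s : ℕ) = b ∨ (s : ℕ) + 1 = b ∨ (b : ℕ) + 1 = s := by
      rw [typeB_apply] at hb
      split_ifs at hb <;> simp_all
    rcases h3 with h3 | h3 | h3
    · have h4 : ((u.map Fin.val).filter fun x => x = s.val ∨ x = b.val) =
          (adjProj s (u.map Fin.val)).filter fun x => x = s.val := by
        rw [adjProj, List.filter_filter]
        congr 1
        funext x
        simp [← h3]
        omega
      obtain ⟨y, hy⟩ := List.getLast?_eq_some_iff.1 h1
      rw [h4, hy]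
      simp
    · rw [← h3]
      exact h1
    · rw [← h2 _ h3]
      congr 1
      rw [adjProj, ← h3]
      simp only [or_comm]

/-- No word with the same projections as `U` contains a square or a long braid word of
type `B_n`. -/
def AvoidsBraidsB (n : ℕ) (U : List ℕ) : Prop :=
  ∀ V, TraceEq U V → (∀ a, ¬[a, a] <:+: V) ∧
    (∀ a b, (a + 1 = b ∨ b + 1 = a) → a + 1 ≠ n → b + 1 ≠ n → ¬[a, b, a] <:+: V) ∧
    ∀ a b, (a + 1 = b ∨ b + 1 = a) → (a + 1 = n ∨ b + 1 = n) → ¬[a, b, a, b] <:+: V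

theorem avoidsBraids_typeB_iff {n : ℕ} {u : List (Fin n)} :
    AvoidsBraids (typeB n) u ↔ AvoidsBraidsB n (u.map Fin.val) := by
  constructor
  · intro h V hV
    obtain ⟨v, rfl⟩ : ∃ v : List (Fin n), V = v.map Fin.val := by
      have hV' : ∀ x ∈ V, x < n := by
        intro x hx
        rw [← hV.mem_iff] at hx
        obtain ⟨a, -, rfl⟩ := List.mem_map.1 hx
        exact a.2
      refine ⟨V.attach.map fun x => ⟨x.1, hV' _ x.2⟩, ?_⟩
      simp
    obtain ⟨h1, h2⟩ := h v (commEquiv_typeB_iff.2 hV)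
    have hlt : ∀ L : List ℕ, L <:+: v.map Fin.val → ∀ x ∈ L, x < n := by
      intro L hL x hx
      obtain ⟨a, -, rfl⟩ := List.mem_map.1 (hL.subset hx)
      exact a.2
    have hinf : ∀ l : List (Fin n), l.map Fin.val <:+: v.map Fin.val → l <:+: v := by
      rintro l ⟨x, y, hxy⟩
      obtain ⟨p, q, rfl, hp, hq⟩ := List.map_eq_append_iff.1 hxy.symm
      obtain ⟨p1, p2, rfl, hp1, hp2⟩ := List.map_eq_append_iff.1 hp
      rw [List.map_injective_iff.2 Fin.val_injective hp2]
      exact ⟨p1, q, rfl⟩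
    refine ⟨fun a ha => ?_, fun a b hab han hbn ha => ?_, fun a b hab hn ha => ?_⟩
    · have := hlt _ ha a (by simp)
      exact h1 ⟨a, this⟩ (hinf _ (by simpa using ha))
    · have ha1 := hlt _ ha a (by simp)
      have hb1 := hlt _ ha b (by simp)
      have hM : typeB n ⟨b, hb1⟩ ⟨a, ha1⟩ = 3 := by
        rw [typeB_apply]; simp only; split_ifs <;> omega
      refine h2 ⟨b, hb1⟩ ⟨a, ha1⟩ (by omega) (hinf _ ?_)
      rw [hM]
      simpa [alternatingWord] using ha
    · have ha1 := hlt _ ha a (by simp)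
      have hb1 := hlt _ ha b (by simp)
      have hM : typeB n ⟨a, ha1⟩ ⟨b, hb1⟩ = 4 := by
        rw [typeB_apply]; simp only; split_ifs <;> omega
      refine h2 ⟨a, ha1⟩ ⟨b, hb1⟩ (by omega) (hinf _ ?_)
      rw [hM]
      simpa [alternatingWord] using ha
  · intro h v hv
    obtain ⟨h1, h2, h3⟩ := h _ (commEquiv_typeB_iff.1 hv)
    refine ⟨fun a ha => h1 a (by simpa using ha.map Fin.val), fun a b hab ha => ?_⟩
    have ha' := ha.map Fin.val
    rw [typeB_apply] at hab ha'
    split_ifs at hab ha' with e1 e2 e3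
    · omega
    · exact h3 a b e2 e3 (by simpa [alternatingWord] using ha')
    · push Not at e3
      exact h2 b a e2.symm e3.2 e3.1 (by simpa [alternatingWord] using ha')
    · omega

theorem exists_amalgamation {α : Type*} (P Q : α → Bool) (u v : List α)
    (hu : ∀ x ∈ u, P x) (hv : ∀ x ∈ v, Q x) (h : u.filter Q = v.filter P) :
    ∃ w : List α, w.filter P = u ∧ w.filter Q = v ∧ ∀ x ∈ w, P x ∨ Q x := by
  induction u generalizing v with
  | nil =>
    refine ⟨v, ?_, ?_, fun x hx => Or.inr (hv x hx)⟩
    · simpa using h.symm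
    · rw [List.filter_eq_self]; exact hv
  | cons a u ih =>
    have hPa : P a := hu a (by simp)
    by_cases hQa : Q a
    · rw [List.filter_cons_of_pos (by simpa using hQa)] at h
      obtain ⟨y, z, rfl, hy, -, hz⟩ := List.filter_eq_cons_iff.1 h.symm
      obtain ⟨w, h1, h2, h3⟩ := ih z (fun x hx => hu x (by simp [hx]))
        (fun x hx => hv x (by simp [hx])) hz.symm
      have hy1 : y.filter P = [] := by
        rw [List.filter_eq_nil_iff]; exact hy
      have hy2 : y.filter Q = y := by
        rw [List.filter_eq_self]; exact fun x hx => hv x (by simp [hx])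
      refine ⟨y ++ a :: w, ?_, ?_, ?_⟩
      · simp [hPa, hy1, h1]
      · simp [hQa, hy2, h2]
      · intro x hx
        simp only [List.mem_append, List.mem_cons] at hx
        rcases hx with hx | rfl | hx
        · exact Or.inr (hv x (by simp [hx]))
        · exact Or.inl hPa
        · exact h3 x hx
    · rw [List.filter_cons_of_neg (by simpa using hQa)] at h
      obtain ⟨w, h1, h2, h3⟩ := ih v (fun x hx => hu x (by simp [hx])) hv h
      refine ⟨a :: w, ?_, ?_, ?_⟩
      · simp [hPa, h1]
      · simp [hQa, h2]
      · intro x hx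
        rcases List.mem_cons.1 hx with rfl | hx
        · exact Or.inl hPa
        · exact h3 x hx

theorem exists_adjProj_eq (p : ℕ → List ℕ) (hp : ∀ i, ∀ x ∈ p i, x = i ∨ x = i + 1)
    (hc : ∀ i, (p i).count (i + 1) = (p (i + 1)).count (i + 1)) (n : ℕ)
    (hn : ∀ i, n ≤ i → p i = []) : ∃ U : List ℕ, ∀ i, adjProj i U = p i := by
  have main : ∀ m, ∃ U : List ℕ, (∀ x ∈ U, x ≤ m) ∧ (∀ i < m, adjProj i U = p i) ∧
      U.count m = (p m).count m := by
    intro m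
    induction m with
    | zero =>
      refine ⟨List.replicate ((p 0).count 0) 0, ?_, ?_, ?_⟩ <;> simp
    | succ m ih =>
      obtain ⟨U, h1, h2, h3⟩ := ih
      obtain ⟨V, hV1, hV2, hV3⟩ := exists_amalgamation (fun x => decide (x ≤ m))
        (fun x => decide (x = m ∨ x = m + 1)) U (p m) (by simpa using h1)
        (by simpa using hp m) (by
          have e1 : (U.filter fun x => decide (x = m ∨ x = m + 1)) =
              List.replicate (U.count m) m := by
            rw [← List.filter_beq]
            apply List.filter_congr
            intro x hx
            have := h1 x hx
            by_cases hxm : x = m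
            · simp [hxm]
            · have : x ≠ m + 1 := by omega
              simp [hxm, this]
          have e2 : ((p m).filter fun x => decide (x ≤ m)) =
              List.replicate ((p m).count m) m := by
            rw [← List.filter_beq]
            apply List.filter_congr
            intro x hx
            rcases hp m x hx with rfl | rfl <;> simp
          rw [e1, e2, h3])
      refine ⟨V, ?_, ?_, ?_⟩
      · intro x hx
        have := hV3 x hx
        simp only [decide_eq_true_eq] at this
        omega
      · intro i hi
        rcases Nat.lt_succ_iff_lt_or_eq.1 hi with hi | rfl
        · rw [← h2 i hi, ← hV1, adjProj, adjProj, List.filter_filter]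
          apply List.filter_congr
          intro x _
          simp only [← Bool.decide_and, decide_eq_decide]
          omega
        · exact hV2
      · rw [← hc m, ← hV2, List.count_filter (by simp)]
  obtain ⟨U, h1, h2, h3⟩ := main n
  refine ⟨U, fun i => ?_⟩
  rcases lt_or_ge i n with hi | hi
  · exact h2 i hi
  · rw [hn i hi, adjProj_eq_nil_iff]
    have h4 : n ∉ U := by
      rw [← List.count_eq_zero, h3, hn n le_rfl]
      simp
    have h5 : ∀ k, n ≤ k → k ∉ U := by
      intro k hk hkU
      have := h1 k hkU
      exact h4 (by rwa [show n = k by omega])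
    exact ⟨h5 i hi, h5 (i + 1) (by omega)⟩

theorem List.exists_two_of_two_le_count {a : ℕ} {l : List ℕ} (h : 2 ≤ l.count a) :
    ∃ x y z, l = x ++ a :: (y ++ a :: z) ∧ a ∉ x ∧ a ∉ y := by
  obtain ⟨x, t, rfl, hx⟩ := List.eq_append_cons_of_mem
    (List.count_pos_iff.1 (show 0 < l.count a by omega))
  have ht : 0 < t.count a := by
    rw [List.count_append, List.count_eq_zero_of_not_mem hx, List.count_cons_self] at h
    omega
  obtain ⟨y, z, rfl, hy⟩ := List.eq_append_cons_of_mem (List.count_pos_iff.1 ht)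
  exact ⟨x, y, z, rfl, hx, hy⟩

/-- The word `U` contains two consecutive occurrences of `i` with no `i - 1` in between. -/
def HasGap (i : ℕ) (U : List ℕ) : Prop :=
  ∃ x y z, U = x ++ i :: (y ++ i :: z) ∧ i ∉ y ∧ ∀ b ∈ y, b + 1 ≠ i

namespace AvoidsBraidsB

variable {n : ℕ} {U : List ℕ}

theorem reverse (h : AvoidsBraidsB n U) : AvoidsBraidsB n U.reverse := by
  intro V hV
  obtain ⟨h1, h2, h3⟩ := h V.reverse (by simpa using hV.reverse)
  refine ⟨fun a ha => h1 a ?_, fun a b hab ha hb hi => h2 a b hab ha hb ?_,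
    fun a b hab hn hi => h3 b a hab.symm hn.symm ?_⟩
  · simpa using List.reverse_infix.2 ha
  · simpa using List.reverse_infix.2 hi
  · simpa using List.reverse_infix.2 hi

theorem filter_neighbor_ne_nil (h : AvoidsBraidsB n U) {i : ℕ} {x y z : List ℕ}
    (hU : U = x ++ i :: (y ++ i :: z)) (hy : i ∉ y) :
    y.filter (fun b => b + 1 = i ∨ b = i + 1) ≠ [] := by
  intro hnil
  rw [List.filter_eq_nil_iff] at hnil
  have h1 : TraceEq (i :: y) (y ++ [i]) := TraceEq.move fun b hb => by
    have := hnil b hb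
    simp only [decide_eq_true_eq] at this
    refine ⟨?_, by omega, by omega⟩
    rintro rfl
    exact hy hb
  have h2 : TraceEq U (x ++ (y ++ [i]) ++ (i :: z)) := by
    have := ((TraceEq.refl x).append h1).append (TraceEq.refl (i :: z))
    simpa [hU] using this
  exact (h _ h2).1 i ⟨x ++ y, z, by simp⟩

theorem of_filter_neighbor_eq (h : AvoidsBraidsB n U) {i b : ℕ} {x y z : List ℕ}
    (hU : U = x ++ i :: (y ++ i :: z)) (hy : i ∉ y)
    (hb : y.filter (fun b => b + 1 = i ∨ b = i + 1) = [b]) : i + 1 = n ∨ b + 1 = n := by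
  by_contra hcon
  push Not at hcon
  obtain ⟨y1, y2, rfl, hy1, hbi, hy2⟩ := List.filter_eq_cons_iff.1 hb
  rw [List.filter_eq_nil_iff] at hy2
  simp only [decide_eq_true_eq] at hbi hy1 hy2
  simp only [List.mem_append, List.mem_cons, not_or] at hy
  have h1 : TraceEq (i :: y1) (y1 ++ [i]) := TraceEq.move fun c hc => by
    have := hy1 c hc
    refine ⟨?_, by omega, by omega⟩
    rintro rfl
    exact hy.1 hc
  have h2 : TraceEq (i :: y2) (y2 ++ [i]) := TraceEq.move fun c hc => by
    have := hy2 c hc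
    refine ⟨?_, by omega, by omega⟩
    rintro rfl
    exact hy.2.2 hc
  have h3 : TraceEq U (x ++ (y1 ++ [i]) ++ [b] ++ (i :: y2) ++ z) := by
    have := ((((TraceEq.refl x).append h1).append (TraceEq.refl [b])).append h2.symm).append
      (TraceEq.refl z)
    simpa [hU] using this
  exact (h _ h3).2.1 i b (by omega) hcon.1 hcon.2 ⟨x ++ y1, y2 ++ z, by simp⟩

/-- Between two consecutive occurrences of `i` there is an occurrence of `i + 1`. -/
theorem succ_mem (h : AvoidsBraidsB n U) {i : ℕ} (hi : i + 1 < n) {x y z : List ℕ}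
    (hU : U = x ++ i :: (y ++ i :: z)) (hy : i ∉ y) : i + 1 ∈ y := by
  induction i generalizing x y z with
  | zero =>
    by_contra hcon
    refine h.filter_neighbor_ne_nil hU hy ?_
    rw [List.filter_eq_nil_iff]
    intro b hb
    simp only [decide_eq_true_eq]
    rintro (h1 | rfl)
    · omega
    · exact hcon hb
  | succ i ih =>
    by_contra hcon
    have h1 : y.filter (fun b => b + 1 = i + 1 ∨ b = i + 1 + 1) =
        List.replicate (y.count i) i := by
      rw [← List.filter_beq]
      apply List.filter_congr
      intro b hb
      have : b ≠ i + 1 + 1 := by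
        rintro rfl
        exact hcon hb
      by_cases hbi : b = i <;> simp [hbi, this]
    have h2 := h.filter_neighbor_ne_nil hU hy
    have h3 := h.of_filter_neighbor_eq (b := i) hU hy
    rw [h1] at h2 h3
    have h4 : 2 ≤ y.count i := by
      by_contra hlt
      have : y.count i = 0 ∨ y.count i = 1 := by omega
      rcases this with h5 | h5
      · rw [h5] at h2
        exact h2 rfl
      · rw [h5] at h3
        have := h3 rfl
        omega
    obtain ⟨y1, y2, y3, rfl, -, hy2⟩ := List.exists_two_of_two_le_count h4
    have := ih (by omega) (x := x ++ (i + 1) :: y1) (y := y2) (z := y3 ++ (i + 1) :: z)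
      (by simp [hU]) hy2
    exact hy (by simp [this])

theorem two_le_count_of_gap (h : AvoidsBraidsB n U) {i : ℕ} (hi : i + 2 < n) {x y z : List ℕ}
    (hU : U = x ++ i :: (y ++ i :: z)) (hy : i ∉ y) (hy' : ∀ b ∈ y, b + 1 ≠ i) :
    2 ≤ y.count (i + 1) := by
  have h1 : y.filter (fun b => b + 1 = i ∨ b = i + 1) =
      List.replicate (y.count (i + 1)) (i + 1) := by
    rw [← List.filter_beq]
    apply List.filter_congr
    intro b hb
    have := hy' b hb
    by_cases hbi : b = i + 1 <;> simp [hbi, this]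
  have h2 := h.filter_neighbor_ne_nil hU hy
  have h3 := h.of_filter_neighbor_eq (b := i + 1) hU hy
  rw [h1] at h2 h3
  by_contra hlt
  have : y.count (i + 1) = 0 ∨ y.count (i + 1) = 1 := by omega
  rcases this with h5 | h5
  · rw [h5] at h2
    exact h2 rfl
  · rw [h5] at h3
    have := h3 rfl
    omega

theorem false_of_gap_last (h : AvoidsBraidsB n U) (hlt : ∀ x ∈ U, x < n) {i : ℕ}
    (hi : i + 1 = n) {x y z : List ℕ} (hU : U = x ++ i :: (y ++ i :: z)) (hy : i ∉ y)
    (hy' : ∀ b ∈ y, b + 1 ≠ i) : False := by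
  refine h.filter_neighbor_ne_nil hU hy ?_
  rw [List.filter_eq_nil_iff]
  intro b hb
  have := hlt b (by simp [hU, hb])
  have := hy' b hb
  simp only [decide_eq_true_eq]
  omega

theorem false_of_long_braid (h : AvoidsBraidsB n U) (hlt : ∀ x ∈ U, x < n) {i : ℕ}
    (hi : i + 2 = n) {x y1 y2 z1 z2 : List ℕ}
    (hU : U = x ++ i :: ((y1 ++ (i + 1) :: y2) ++ i :: (z1 ++ (i + 1) :: z2)))
    (hy1 : ∀ b ∈ y1, b ≠ i ∧ b ≠ i + 1 ∧ b + 1 ≠ i)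
    (hy2 : ∀ b ∈ y2, b ≠ i ∧ b ≠ i + 1 ∧ b + 1 ≠ i)
    (hz1 : ∀ b ∈ z1, b ≠ i ∧ b ≠ i + 1) : False := by
  have h1 := TraceEq.move hy1
  have h2 := (TraceEq.move hy2).symm
  have h3 : TraceEq ((i + 1) :: (y2 ++ z1)) ((y2 ++ z1) ++ [i + 1]) :=
    TraceEq.move fun b hb => by
      rw [List.mem_append] at hb
      have h5 : b < n := hlt b (by rcases hb with hb | hb <;> simp [hU, hb])
      have h6 : b ≠ i ∧ b ≠ i + 1 := by
        rcases hb with hb | hb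
        · exact ⟨(hy2 b hb).1, (hy2 b hb).2.1⟩
        · exact hz1 b hb
      omega
  have h4 : TraceEq U (x ++ (y1 ++ [i]) ++ [i + 1] ++ (i :: y2) ++ (z1 ++ (i + 1) :: z2)) := by
    have := ((((TraceEq.refl x).append h1).append (TraceEq.refl [i + 1])).append h2).append
      (TraceEq.refl (z1 ++ (i + 1) :: z2))
    simpa [hU] using this
  have h5 := (((TraceEq.refl (x ++ (y1 ++ [i]) ++ [i + 1] ++ [i])).append h3.symm).append
    (TraceEq.refl z2))
  refine (h (x ++ (y1 ++ [i]) ++ [i + 1] ++ [i] ++ ((i + 1) :: (y2 ++ z1)) ++ z2) ?_).2.2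
    i (i + 1) (Or.inl rfl) (Or.inr hi) ⟨x ++ y1, y2 ++ z1 ++ z2, by simp⟩
  exact h4.trans (by simpa using h5)

theorem gap_penultimate (h : AvoidsBraidsB n U) (hlt : ∀ x ∈ U, x < n) {i : ℕ}
    (hi : i + 2 = n) {x y z : List ℕ} (hU : U = x ++ i :: (y ++ i :: z)) (hy : i ∉ y)
    (hy' : ∀ b ∈ y, b + 1 ≠ i) : adjProj i y = [i + 1] ∧ adjProj i z = [] := by
  have h1 := h.filter_neighbor_ne_nil hU hy
  obtain ⟨b, hb⟩ := List.exists_mem_of_ne_nil _ h1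
  simp only [List.mem_filter, decide_eq_true_eq] at hb
  have hmem : i + 1 ∈ y := by
    have := hy' b hb.1
    obtain rfl : b = i + 1 := by omega
    exact hb.1
  obtain ⟨y1, y2, rfl, hy1⟩ := List.eq_append_cons_of_mem hmem
  have hy2 : i + 1 ∉ y2 := by
    intro hcon
    obtain ⟨y3, y4, rfl, hy3⟩ := List.eq_append_cons_of_mem hcon
    refine h.false_of_gap_last hlt (i := i + 1) (by omega) (x := x ++ i :: y1) (y := y3)
      (z := y4 ++ i :: z) (by simp [hU]) hy3 ?_
    intro c hc hci
    obtain rfl : c = i := by omega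
    exact hy (by simp [hc])
  simp only [List.mem_append, List.mem_cons, not_or] at hy hy'
  refine ⟨?_, ?_⟩
  · rw [adjProj_append, adjProj_cons, if_pos (Or.inr rfl), adjProj_eq_nil_iff.2 ⟨hy.1, hy1⟩,
      adjProj_eq_nil_iff.2 ⟨hy.2.2, hy2⟩]
    rfl
  · rcases hz : adjProj i z with _ | ⟨c, t⟩
    · rfl
    · exfalso
      obtain ⟨z1, z2, rfl, hz1, hc, -⟩ := List.filter_eq_cons_iff.1 hz
      simp only [decide_eq_true_eq, not_or] at hz1 hc
      rcases hc with rfl | rfl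
      · have := h.succ_mem (by omega) (x := x ++ c :: (y1 ++ (c + 1) :: y2)) (y := z1) (z := z2)
          (by simp [hU]) (fun hm => (hz1 c hm).1 rfl)
        exact (hz1 _ this).2 rfl
      · refine h.false_of_long_braid hlt hi hU (fun d hd => ⟨?_, ?_, hy' d (Or.inl hd)⟩)
          (fun d hd => ⟨?_, ?_, hy' d (Or.inr (Or.inr hd))⟩) hz1
        · rintro rfl; exact hy.1 hd
        · rintro rfl; exact hy1 hd
        · rintro rfl; exact hy.2.2 hd
        · rintro rfl; exact hy2 hd

/-- The projections of a word above a gap are determined. -/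
theorem adjProj_of_hasGap (h : AvoidsBraidsB n U) (hlt : ∀ x ∈ U, x < n) {i : ℕ}
    (hg : HasGap i U) :
    (i + 2 = n ∧ adjProj i U = [i, i + 1, i]) ∨
      (i + 2 < n ∧ adjProj i U = [i, i + 1, i + 1, i] ∧ HasGap (i + 1) U) := by
  have hin : i + 2 ≤ n := by
    obtain ⟨x, y, z, hU, hy, hy'⟩ := hg
    have := hlt i (by simp [hU])
    have : i + 1 ≠ n := fun hi => h.false_of_gap_last hlt hi hU hy hy'
    omega
  obtain ⟨d, hd⟩ := Nat.exists_eq_add_of_le hin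
  have hltr : ∀ x ∈ U.reverse, x < n := by simpa using hlt
  induction d generalizing i with
  | zero =>
    left
    obtain ⟨x, y, z, hU, hy, hy'⟩ := hg
    have h1 := h.gap_penultimate hlt (by omega) hU hy hy'
    have h2 := (h.reverse).gap_penultimate hltr (i := i) (by omega) (x := z.reverse)
      (y := y.reverse) (z := x.reverse) (by simp [hU]) (by simpa) (by simpa)
    refine ⟨by omega, ?_⟩
    have h3 : adjProj i x = [] := by simpa [adjProj_reverse] using h2.2
    simp [hU, adjProj_cons, h1, h3]
  | succ d ih =>
    right
    obtain ⟨x, y, z, hU, hy, hy'⟩ := hg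
    have hc := h.two_le_count_of_gap (by omega) hU hy hy'
    have hg' : HasGap (i + 1) U := by
      obtain ⟨y1, y2, y3, rfl, -, hy2⟩ := List.exists_two_of_two_le_count hc
      refine ⟨x ++ i :: y1, y2, y3 ++ i :: z, by simp [hU], hy2, fun b hb hbi => hy ?_⟩
      obtain rfl : b = i := by omega
      simp [hb]
    have hcU : U.count (i + 1) = 2 := by
      rw [← count_adjProj_self]
      rcases ih hg' (by omega) (by omega) with ⟨-, h1⟩ | ⟨-, h1, -⟩ <;> rw [h1] <;> simp
    have hcU' := hcU
    rw [hU] at hcU'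
    simp only [List.count_append, List.count_cons] at hcU'
    have hx : i + 1 ∉ x := by rw [← List.count_eq_zero]; omega
    have hz : i + 1 ∉ z := by rw [← List.count_eq_zero]; omega
    have key : ∀ W : List ℕ, AvoidsBraidsB n W → ∀ x y z, W = x ++ i :: (y ++ i :: z) →
        i + 1 ∉ z → i ∉ z := by
      intro W hW x y z hWe hz hmem
      obtain ⟨z1, z2, rfl, hz1⟩ := List.eq_append_cons_of_mem hmem
      exact hz (by simp [hW.succ_mem (by omega) (x := x ++ i :: y) (y := z1) (z := z2)
        (by simp [hWe]) hz1])
    have hz' := key U h x y z hU hz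
    have hx' : i ∉ x := by
      have := key U.reverse h.reverse z.reverse y.reverse x.reverse (by simp [hU]) (by simpa)
      simpa using this
    refine ⟨by omega, ?_, hg'⟩
    have hyp : adjProj i y = [i + 1, i + 1] := by
      have h1 : adjProj i y = List.replicate (y.count (i + 1)) (i + 1) := by
        rw [← List.filter_beq]
        apply List.filter_congr
        intro b hb
        have : b ≠ i := by rintro rfl; exact hy hb
        by_cases hbi : b = i + 1 <;> simp [hbi, this]
      rw [h1, show y.count (i + 1) = 2 by omega]
      rfl
    simp [hU, adjProj_cons, adjProj_eq_nil_iff.2 ⟨hx', hx⟩, adjProj_eq_nil_iff.2 ⟨hz', hz⟩, hyp]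

theorem isChain_adjProj (h : AvoidsBraidsB n U) {i : ℕ} (hi : i + 1 < n)
    (hg : ¬HasGap (i + 1) U) : (adjProj i U).IsChain (· ≠ ·) := by
  rw [List.isChain_iff_forall_rel_of_append_cons_cons]
  rintro a b l1 l2 hl rfl
  obtain ⟨x, t, rfl, -, ht⟩ := List.filter_eq_append_iff.1 hl
  obtain ⟨x', t, rfl, hx', ha, ht⟩ := List.filter_eq_cons_iff.1 ht
  obtain ⟨y, z, rfl, hy, -, -⟩ := List.filter_eq_cons_iff.1 ht
  simp only [decide_eq_true_eq, not_or] at ha hy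
  rcases ha with rfl | rfl
  · have := h.succ_mem hi (x := x ++ x') (y := y) (z := z) (by simp) (fun hm => (hy _ hm).1 rfl)
    exact (hy _ this).2 rfl
  · refine hg ⟨x ++ x', y, z, by simp, fun hm => (hy _ hm).2 rfl, fun b hb hbi => ?_⟩
    exact (hy b hb).1 (by omega)

end AvoidsBraidsB

theorem qbinom_zero_right (n : ℕ) : qbinom n 0 = 1 := by
  cases n <;> rfl

theorem qbinom_succ_succ (n k : ℕ) :
    qbinom (n + 1) (k + 1) = qbinom n k + Polynomial.X ^ (k + 1) * qbinom n (k + 1) := rfl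

theorem qbinom_eq_zero_of_lt : ∀ {n k : ℕ}, n < k → qbinom n k = 0
  | 0, k + 1, _ => rfl
  | n + 1, k + 1, h => by
    rw [qbinom_succ_succ, qbinom_eq_zero_of_lt (by omega), qbinom_eq_zero_of_lt (by omega)]
    simp

theorem qbinom_self : ∀ n : ℕ, qbinom n n = 1
  | 0 => rfl
  | n + 1 => by
    rw [qbinom_succ_succ, qbinom_self n, qbinom_eq_zero_of_lt (Nat.lt_succ_self n)]
    simp

/-- The second `q`-Pascal recursion. -/
theorem qbinom_add_succ (k m : ℕ) :
    qbinom (k + m + 1) (k + 1) =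
      Polynomial.X ^ m * qbinom (k + m) k + qbinom (k + m) (k + 1) := by
  induction m generalizing k with
  | zero => simp [qbinom_self, qbinom_eq_zero_of_lt]
  | succ m ih =>
    induction k with
    | zero =>
      have h := ih 0
      simp only [Nat.zero_add, qbinom_zero_right, qbinom_succ_succ] at h ⊢
      linear_combination (Polynomial.X) * h
    | succ k ihk =>
      have h1 := qbinom_succ_succ (k + 1 + (m + 1)) (k + 1)
      have h2 := qbinom_succ_succ (k + m + 1) (k)
      have h3 := qbinom_succ_succ (k + m + 1) (k + 1)
      have h4 := ih (k + 1)
      simp only [show k + 1 + (m + 1) = k + m + 1 + 1 by ring,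
        show k + 1 + m = k + m + 1 by ring, show k + (m + 1) = k + m + 1 by ring] at *
      linear_combination h1 + ihk + Polynomial.X ^ (k + 1 + 1) * h4 -
        Polynomial.X ^ (m + 1) * h2 - h3

theorem qbinom_symm (k m : ℕ) : qbinom (k + m) k = qbinom (k + m) m := by
  induction k generalizing m with
  | zero => simp [qbinom_self, qbinom_zero_right]
  | succ k ih =>
    induction m with
    | zero => simp [qbinom_self, qbinom_zero_right]
    | succ m ihm =>
      have h1 := qbinom_add_succ k (m + 1)
      have h2 := qbinom_succ_succ (k + m + 1) m
      have h3 := ih (m + 1)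
      simp only [show k + (m + 1) = k + m + 1 by ring,
        show k + 1 + m = k + m + 1 by ring, show k + 1 + (m + 1) = k + m + 1 + 1 by ring] at *
      rw [h1, h2, h3, ihm]
      ring

/-- Sum of `i + 1` over the `i < N` such that `i ∈ A` and `i + 1 ∉ A`. -/
def peakSum (N : ℕ) (A : Finset ℕ) : ℕ :=
  ∑ i ∈ Finset.range N, if i ∈ A ∧ i + 1 ∉ A then i + 1 else 0

/-- The height after `k` steps of the path whose `i`-th step goes up when `i ∈ A`, and otherwise
goes down, or stays level at height zero. -/
def height (A : Finset ℕ) : ℕ → ℕ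
  | 0 => 0
  | k + 1 => if k ∈ A then height A k + 1 else height A k - 1

theorem peakSum_succ_of_notMem {n : ℕ} {A : Finset ℕ} (h : n ∉ A) :
    peakSum (n + 1) A = peakSum n A := by
  simp [peakSum, Finset.sum_range_succ, h]

theorem peakSum_insert {n : ℕ} {A : Finset ℕ} :
    peakSum n (insert n A) = peakSum (n - 1) A := by
  cases n with
  | zero => simp [peakSum]
  | succ n =>
    rw [peakSum, Finset.sum_range_succ, peakSum]
    simp only [Finset.mem_insert, true_or, not_true_eq_false, and_false, if_false, add_zero,
      Nat.add_sub_cancel]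
    refine Finset.sum_congr rfl fun i hi => ?_
    rw [Finset.mem_range] at hi
    simp [show i ≠ n + 1 by omega, show i ≠ n by omega]

theorem peakSum_succ_insert {n : ℕ} {A : Finset ℕ} (h : A ⊆ Finset.range n) :
    peakSum (n + 1) (insert n A) = peakSum (n - 1) A + (n + 1) := by
  have : n + 1 ∉ insert n A := by
    intro hn
    rcases Finset.mem_insert.1 hn with hn | hn
    · omega
    · have := Finset.mem_range.1 (h hn); omega
  rw [← peakSum_insert]
  conv_lhs => rw [peakSum, Finset.sum_range_succ, ← peakSum]
  simp [this]

theorem peakSum_of_subset {n m : ℕ} {A : Finset ℕ} (h : A ⊆ Finset.range n) (hm : n ≤ m) :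
    peakSum m A = peakSum n A := by
  induction m, hm using Nat.le_induction with
  | base => rfl
  | succ m hm ih =>
    rw [peakSum_succ_of_notMem, ih]
    intro h'
    have := Finset.mem_range.1 (h h')
    omega

theorem height_congr {A B : Finset ℕ} {n : ℕ} (h : ∀ i < n, i ∈ A ↔ i ∈ B) :
    height A n = height B n := by
  induction n with
  | zero => rfl
  | succ n ih => simp only [height, ih fun i hi => h i (by omega), h n (by omega)]

theorem height_insert (n : ℕ) (A : Finset ℕ) :
    height (insert n A) n = height A n :=
  height_congr fun i hi => by simp [hi.ne]

theorem sum_powerset_range_succ {β : Type*} [AddCommMonoid β] (n : ℕ) (f : Finset ℕ → β) :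
    ∑ A ∈ (Finset.range (n + 1)).powerset, f A =
      ∑ A ∈ (Finset.range n).powerset, f A + ∑ A ∈ (Finset.range n).powerset, f (insert n A) := by
  rw [Finset.range_add_one, Finset.sum_powerset_insert Finset.notMem_range_self]

/-- MacMahon's formula for the major index of subsets with `k` elements. -/
theorem sum_peakSum_card (n k : ℕ) :
    (∑ A ∈ (Finset.range n).powerset,
        (if A.card = k then (Polynomial.X : Polynomial ℤ) ^ peakSum (n - 1) A else 0)) =
      qbinom n k ∧
    (∑ A ∈ (Finset.range n).powerset,
        (if A.card = k then (Polynomial.X : Polynomial ℤ) ^ peakSum n A else 0)) =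
      Polynomial.X ^ k * qbinom n k := by
  induction n generalizing k with
  | zero => cases k <;> simp [peakSum, qbinom]
  | succ n ih =>
    have hA : ∀ A ∈ (Finset.range n).powerset, n ∉ A := fun A hA h => by
      simpa using Finset.mem_powerset.1 hA h
    rw [sum_powerset_range_succ, sum_powerset_range_succ, Nat.add_sub_cancel]
    have e1 : ∀ A ∈ (Finset.range n).powerset,
        (if (insert n A).card = k then (Polynomial.X : Polynomial ℤ) ^ peakSum n (insert n A)
          else 0) = if A.card + 1 = k then Polynomial.X ^ peakSum (n - 1) A else 0 := by
      intro A h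
      rw [Finset.card_insert_of_notMem (hA A h), peakSum_insert]
    have e2 : ∀ A ∈ (Finset.range n).powerset,
        (if (insert n A).card = k then
          (Polynomial.X : Polynomial ℤ) ^ peakSum (n + 1) (insert n A) else 0) =
        Polynomial.X ^ (n + 1) *
          if A.card + 1 = k then Polynomial.X ^ peakSum (n - 1) A else 0 := by
      intro A h
      rw [Finset.card_insert_of_notMem (hA A h), peakSum_succ_insert (Finset.mem_powerset.1 h)]
      split_ifs <;> ring
    have e3 : ∀ A ∈ (Finset.range n).powerset,
        (if A.card = k then (Polynomial.X : Polynomial ℤ) ^ peakSum (n + 1) A else 0) =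
        if A.card = k then Polynomial.X ^ peakSum n A else 0 := by
      intro A h
      rw [peakSum_succ_of_notMem (hA A h)]
    rw [Finset.sum_congr rfl e1, Finset.sum_congr rfl e2, Finset.sum_congr rfl e3,
      ← Finset.mul_sum, (ih k).2]
    cases k with
    | zero => simp [qbinom_zero_right]
    | succ k =>
      simp only [Nat.add_right_cancel_iff, (ih k).1, qbinom_succ_succ]
      refine ⟨by ring, ?_⟩
      rcases lt_or_ge n k with h | h
      · simp [qbinom_eq_zero_of_lt h, qbinom_eq_zero_of_lt (h.trans (Nat.lt_succ_self k))]
      · obtain ⟨m, rfl⟩ := Nat.exists_eq_add_of_le h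
        have h1 := qbinom_add_succ k m
        rw [qbinom_succ_succ] at h1
        linear_combination (-Polynomial.X ^ (k + 1)) * h1

theorem sum_peakSum_powerset (n : ℕ) :
    ∑ A ∈ (Finset.range n).powerset, (Polynomial.X : Polynomial ℤ) ^ peakSum n A =
      1 + ∑ h ∈ Finset.Icc 1 n, Polynomial.X ^ h * ∑ i ∈ Finset.range h, qbinom (h - 1) i := by
  induction n with
  | zero => simp [peakSum]
  | succ n ih =>
    rw [sum_powerset_range_succ, Finset.sum_Icc_succ_top (by omega), ← add_assoc, ← ih,
      Nat.add_sub_cancel]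
    congr 1
    · refine Finset.sum_congr rfl fun A h => ?_
      rw [peakSum_succ_of_notMem fun h' => by simpa using Finset.mem_powerset.1 h h']
    · have : ∀ A ∈ (Finset.range n).powerset,
          (Polynomial.X : Polynomial ℤ) ^ peakSum (n + 1) (insert n A) =
          Polynomial.X ^ (n + 1) * Polynomial.X ^ peakSum (n - 1) A := fun A h => by
        rw [peakSum_succ_insert (Finset.mem_powerset.1 h)]; ring
      rw [Finset.sum_congr rfl this, ← Finset.mul_sum]
      congr 1
      simp_rw [← (sum_peakSum_card n _).1]
      rw [Finset.sum_comm]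
      refine Finset.sum_congr rfl fun A h => ?_
      have := Finset.card_le_card (Finset.mem_powerset.1 h)
      rw [Finset.card_range] at this
      rw [Finset.sum_ite_eq, if_pos (Finset.mem_range.2 (by omega))]

/-- The generating polynomial of `peakSum N` over the subsets of `range n` whose path ends at
height `h`. -/
noncomputable def heightGF (N n h : ℕ) : Polynomial ℤ :=
  ∑ A ∈ (Finset.range n).powerset, if height A n = h then Polynomial.X ^ peakSum N A else 0

theorem heightGF_eq (N n h : ℕ) (hN : n ≤ N) : heightGF N n h = heightGF n n h :=
  Finset.sum_congr rfl fun A hA => by rw [peakSum_of_subset (Finset.mem_powerset.1 hA) hN]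

theorem height_succ_of_subset {n : ℕ} {A : Finset ℕ} (h : A ⊆ Finset.range n) :
    height A (n + 1) = height A n - 1 := by
  rw [height, if_neg fun h' => by simpa using h h']

theorem height_succ_insert (n : ℕ) (A : Finset ℕ) :
    height (insert n A) (n + 1) = height A n + 1 := by
  simp [height, height_insert]

theorem heightGF_down (n h : ℕ) :
    ∑ A ∈ (Finset.range n).powerset,
      (if height A (n + 1) = h then (Polynomial.X : Polynomial ℤ) ^ peakSum n A else 0) =
    heightGF n n (h + 1) + if h = 0 then heightGF n n 0 else 0 := by
  rw [heightGF, heightGF]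
  rcases Nat.eq_zero_or_pos h with rfl | hpos
  · rw [if_pos rfl, ← Finset.sum_add_distrib]
    refine Finset.sum_congr rfl fun A hA => ?_
    rw [height_succ_of_subset (Finset.mem_powerset.1 hA)]
    rcases Nat.lt_trichotomy (height A n) 1 with h | h | h
    · simp [show height A n = 0 by omega]
    · simp [h]
    · simp [show height A n - 1 ≠ 0 by omega, show height A n ≠ 0 by omega,
        show height A n ≠ 1 by omega]
  · rw [if_neg (by omega), add_zero]
    refine Finset.sum_congr rfl fun A hA => ?_
    rw [height_succ_of_subset (Finset.mem_powerset.1 hA)]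
    congr 1
    apply propext
    omega

theorem heightGF_succ (n h : ℕ) :
    heightGF n (n + 1) h = (heightGF n n (h + 1) + if h = 0 then heightGF n n 0 else 0) +
      if h = 0 then 0 else heightGF (n - 1) n (h - 1) := by
  rw [heightGF, sum_powerset_range_succ, heightGF_down]
  congr 1
  rcases Nat.eq_zero_or_pos h with rfl | hpos
  · simp [height_succ_insert]
  · rw [if_neg (by omega), heightGF]
    refine Finset.sum_congr rfl fun A hA => ?_
    rw [height_succ_insert, peakSum_insert]
    congr 1
    apply propext
    omega

theorem heightGF_succ_succ (n h : ℕ) :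
    heightGF (n + 1) (n + 1) h =
      (heightGF n n (h + 1) + if h = 0 then heightGF n n 0 else 0) +
      if h = 0 then 0 else Polynomial.X ^ (n + 1) * heightGF (n - 1) n (h - 1) := by
  rw [heightGF, sum_powerset_range_succ, ← heightGF_down]
  congr 1
  · refine Finset.sum_congr rfl fun A hA => ?_
    rw [peakSum_of_subset (Finset.mem_powerset.1 hA) (Nat.le_succ n)]
  · rcases Nat.eq_zero_or_pos h with rfl | hpos
    · simp [height_succ_insert]
    · rw [if_neg (by omega), heightGF, Finset.mul_sum]
      refine Finset.sum_congr rfl fun A hA => ?_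
      rw [height_succ_insert, peakSum_succ_insert (Finset.mem_powerset.1 hA), mul_ite, mul_zero]
      simp only [show height A n + 1 = h ↔ height A n = h - 1 by omega]
      split_ifs <;> ring

theorem heightGF_formula (n h : ℕ) :
    heightGF (n - 1) n h = (if h ≤ n then qbinom n ((n - h) / 2) else 0) ∧
    heightGF n n h = if h = 0 then qbinom n (n / 2) else
      if h ≤ n then Polynomial.X ^ (n - (n - h) / 2) * qbinom n ((n - h) / 2) else 0 := by
  induction n generalizing h with
  | zero => cases h <;> simp [heightGF, height, peakSum, qbinom]
  | succ n ih =>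
    rw [heightGF_succ_succ, Nat.add_sub_cancel, heightGF_succ, (ih (h + 1)).2, (ih 0).2,
      (ih (h - 1)).1]
    rcases Nat.eq_zero_or_pos h with rfl | hpos
    · have key : (if 0 + 1 ≤ n then Polynomial.X ^ (n - (n - (0 + 1)) / 2) *
          qbinom n ((n - (0 + 1)) / 2) else 0) + qbinom n (n / 2) =
          qbinom (n + 1) ((n + 1) / 2) := by
        rcases Nat.even_or_odd' n with ⟨r, rfl | rfl⟩
        · cases r with
          | zero => simp [qbinom_self, qbinom_zero_right]
          | succ r =>
            have h1 := qbinom_add_succ r (r + 2)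
            rw [if_pos (by omega), show 2 * (r + 1) / 2 = r + 1 by omega,
              show (2 * (r + 1) + 1) / 2 = r + 1 by omega,
              show (2 * (r + 1) - (0 + 1)) / 2 = r by omega,
              show 2 * (r + 1) - r = r + 2 by omega, show 2 * (r + 1) = r + (r + 2) by omega, h1]
        · have h1 := qbinom_succ_succ (2 * r + 1) r
          have h2 := qbinom_symm r (r + 1)
          rw [if_pos (by omega), show (2 * r + 1) / 2 = r by omega,
            show (2 * r + 1 + 1) / 2 = r + 1 by omega,
            show (2 * r + 1 - (0 + 1)) / 2 = r by omega,
            show 2 * r + 1 - r = r + 1 by omega, h1]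
          rw [show r + (r + 1) = 2 * r + 1 by ring] at h2
          rw [h2]
          ring
      simp only [if_true, Nat.sub_zero, Nat.zero_le, add_zero, Nat.succ_ne_zero, if_false] at key ⊢
      exact ⟨key, key⟩
    · have hne : h ≠ 0 := by omega
      have hne' : h + 1 ≠ 0 := by omega
      simp only [if_neg hne, if_neg hne']
      by_cases h1 : h ≤ n + 1
      · have hle : h - 1 ≤ n := by omega
        simp only [if_pos hle, if_pos h1]
        by_cases h2 : h + 1 ≤ n
        · rw [if_pos h2]
          obtain ⟨k, hk⟩ : ∃ k, (n + 1 - h) / 2 = k + 1 := ⟨(n + 1 - h) / 2 - 1, by omega⟩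
          rw [show (n - (h - 1)) / 2 = k + 1 by omega, show (n - (h + 1)) / 2 = k by omega, hk]
          obtain ⟨m, rfl⟩ : ∃ m, n = k + m := ⟨n - k, by omega⟩
          rw [show k + m + 1 - (k + 1) = m by omega, show k + m - k = m by omega,
            qbinom_add_succ]
          refine ⟨by ring, ?_⟩
          have h3 := qbinom_add_succ k m
          have h4 := qbinom_succ_succ (k + m) k
          linear_combination Polynomial.X ^ m * h3 - Polynomial.X ^ m * h4
        · rw [if_neg h2, show (n - (h - 1)) / 2 = 0 by omega, show (n + 1 - h) / 2 = 0 by omega]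
          simp [qbinom_zero_right]
      · have h2 : ¬h + 1 ≤ n := by omega
        have h3 : ¬h - 1 ≤ n := by omega
        simp [h1, h2, h3]

theorem sum_heightGF_one (n : ℕ) (hn : 1 ≤ n) :
    1 + ∑ j ∈ Finset.range (n - 1), heightGF n (j + 1) 1 = qbinom n (n / 2) := by
  obtain ⟨n, rfl⟩ : ∃ m, n = m + 1 := ⟨n - 1, by omega⟩
  rw [Nat.add_sub_cancel]
  have h0 : ∀ m, heightGF m m 0 = qbinom m (m / 2) := fun m => by
    rw [(heightGF_formula m 0).2, if_pos rfl]
  have h1 : ∀ j ∈ Finset.range n, heightGF (n + 1) (j + 1) 1 =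
      qbinom (j + 1 + 1) ((j + 1 + 1) / 2) - qbinom (j + 1) ((j + 1) / 2) := fun j hj => by
    rw [Finset.mem_range] at hj
    rw [heightGF_eq _ _ _ (by omega), ← h0, ← h0, heightGF_succ_succ (j + 1) 0]
    simp
  rw [Finset.sum_congr rfl h1,
    Finset.sum_range_sub fun j => qbinom (j + 1) ((j + 1) / 2)]
  simp [qbinom_zero_right]

/-- The alternating list of length `k` in `a` and `b` starting with `a`. -/
def alternatingList (a b : ℕ) : ℕ → List ℕ
  | 0 => []
  | k + 1 => a :: alternatingList b a k

theorem alternatingList_succ' (a b k : ℕ) :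
    alternatingList a b (k + 1) = alternatingList a b k ++ [if Even k then a else b] := by
  induction k generalizing a b with
  | zero => simp [alternatingList]
  | succ k ih =>
    rw [alternatingList, ih b a]
    by_cases h : Even k <;> simp [h, Nat.even_add_one, alternatingList]

theorem reverse_alternatingList (a b k : ℕ) : (alternatingList a b k).reverse =
    if Even k then alternatingList b a k else alternatingList a b k := by
  induction k with
  | zero => simp [alternatingList]
  | succ k ih =>
    rw [alternatingList_succ', List.reverse_append, ih]
    have h2 := alternatingList_succ' a b k
    by_cases h : Even k
    · simpa [h, Nat.even_add_one, alternatingList] using h2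
    · simp [h, Nat.even_add_one, alternatingList]

theorem count_alternatingList {a b : ℕ} (hab : a ≠ b) (m : ℕ) :
    (alternatingList a b (2 * m)).count a = m ∧ (alternatingList a b (2 * m)).count b = m := by
  induction m with
  | zero => simp [alternatingList]
  | succ m ih =>
    rw [Nat.mul_succ]
    simp only [alternatingList, List.count_cons_self, List.count_cons_of_ne hab,
      List.count_cons_of_ne hab.symm, ih]
    trivial

theorem count_alternatingList_odd {a b : ℕ} (hab : a ≠ b) (m : ℕ) :
    (alternatingList a b (2 * m + 1)).count a = m + 1 ∧
      (alternatingList a b (2 * m + 1)).count b = m := by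
  rw [alternatingList, List.count_cons_self, List.count_cons_of_ne hab]
  have := count_alternatingList hab.symm m
  omega

theorem mem_alternatingList {a b k x : ℕ} (h : x ∈ alternatingList a b k) : x = a ∨ x = b := by
  induction k generalizing a b with
  | zero => simp [alternatingList] at h
  | succ k ih =>
    rcases List.mem_cons.1 h with h | h
    · exact Or.inl h
    · exact (ih h).symm

theorem isChain_alternatingList {a b : ℕ} (hab : a ≠ b) (k : ℕ) :
    (alternatingList a b k).IsChain (· ≠ ·) := by
  induction k generalizing a b with
  | zero => exact List.isChain_nil
  | succ k ih =>
    cases k with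
    | zero => exact List.isChain_singleton _
    | succ k => exact List.isChain_cons_cons.2 ⟨hab, ih hab.symm⟩

theorem eq_alternatingList_of_isChain {a b : ℕ} {L : List ℕ} (hL : ∀ x ∈ L, x = a ∨ x = b)
    (hc : (a :: L).IsChain (· ≠ ·)) : a :: L = alternatingList a b (L.length + 1) := by
  induction L generalizing a b with
  | nil => rfl
  | cons c L ih =>
    rw [List.isChain_cons_cons] at hc
    obtain rfl : c = b := (hL c (by simp)).resolve_left (Ne.symm hc.1)
    exact congrArg (a :: ·) (ih (b := a) (fun x hx => (hL x (by simp [hx])).symm) hc.2)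

/-- A palindromic alternating list is determined by the numbers of occurrences of its letters. -/
theorem eq_alternatingList_of_reverse_eq {a b : ℕ} (hab : a ≠ b) {L : List ℕ}
    (hL : ∀ x ∈ L, x = a ∨ x = b) (hc : L.IsChain (· ≠ ·)) (hr : L.reverse = L) :
    L = [] ∨ (L.count a = L.count b + 1 ∧ L = alternatingList a b (L.count a + L.count b)) ∨
      (L.count b = L.count a + 1 ∧ L = alternatingList b a (L.count a + L.count b)) := by
  have key : ∀ a b : ℕ, a ≠ b → ∀ k, (alternatingList a b (k + 1)).reverse =
      alternatingList a b (k + 1) →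
      (alternatingList a b (k + 1)).count a = (alternatingList a b (k + 1)).count b + 1 ∧
      k + 1 = (alternatingList a b (k + 1)).count a + (alternatingList a b (k + 1)).count b := by
    intro a b hab k h
    rcases Nat.even_or_odd' k with ⟨m, rfl | rfl⟩
    · have := count_alternatingList_odd hab m
      omega
    · rw [reverse_alternatingList, if_pos ⟨m + 1, by ring⟩] at h
      simp only [alternatingList, List.cons.injEq] at h
      exact absurd h.1.symm hab
  rcases L with _ | ⟨c, L⟩
  · exact Or.inl rfl
  right
  rcases hL c (by simp) with rfl | rfl
  · left
    have h1 := eq_alternatingList_of_isChain (fun x hx => hL x (by simp [hx])) hc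
    rw [h1] at hr ⊢
    obtain ⟨h2, h3⟩ := key _ _ hab _ hr
    exact ⟨h2, by rw [← h3]⟩
  · right
    have h1 := eq_alternatingList_of_isChain (fun x hx => (hL x (by simp [hx])).symm) hc
    rw [h1] at hr ⊢
    obtain ⟨h2, h3⟩ := key _ _ hab.symm _ hr
    exact ⟨h2, by rw [add_comm (List.count a _), ← h3]⟩

/-- The projections to adjacent letters of the words of the fully commutative involutions of type
`B_n`, encoded by a set `A` of steps and a column `j`. -/
def fcProj (n j : ℕ) (A : Finset ℕ) (i : ℕ) : List ℕ :=
  if i + 1 < j then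
    if height A (i + 1) < height A (i + 2) then
      alternatingList (i + 1) i (height A (i + 1) + height A (i + 2))
    else alternatingList i (i + 1) (height A (i + 1) + height A (i + 2))
  else if i + 1 = j then
    if j = n then List.replicate (height A j) i
    else if height A j = 0 then [i + 1, i + 1] else [i, i + 1, i + 1, i]
  else if i + 2 < n then [i, i + 1, i + 1, i]
  else if i + 2 = n then [i, i + 1, i]
  else if i + 1 = n then [i] else []

/-- The parameters of the fully commutative involutions of type `B_n`. -/
def IsFCParam (n j : ℕ) (A : Finset ℕ) : Prop :=
  (j = n ∧ A ⊆ Finset.range n) ∨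
    (j + 1 < n ∧ A ⊆ Finset.range (j + 1) ∧ height A (j + 1) = 1)

theorem AvoidsBraidsB.exists_fcProj {n : ℕ} {U : List ℕ} (hlt : ∀ x ∈ U, x < n)
    (h : AvoidsBraidsB n U) (hr : TraceEq U.reverse U) :
    ∃ j A, IsFCParam n j A ∧ ∀ i, adjProj i U = fcProj n j A i := by
  classical
  have hpal : ∀ i, (adjProj i U).reverse = adjProj i U := fun i => by
    rw [← adjProj_reverse, hr i]
  have hge : ∀ i, n ≤ i → i ∉ U := fun i hi hU => by have := hlt i hU; omega
  obtain ⟨j, hjn, hjmin, hj⟩ : ∃ j ≤ n, (∀ i < j, ¬HasGap i U) ∧ (j < n → HasGap j U) := by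
    by_cases hex : ∃ j, HasGap j U
    · refine ⟨Nat.find hex, ?_, fun i hi => Nat.find_min hex hi, fun _ => Nat.find_spec hex⟩
      rcases h.adjProj_of_hasGap hlt (Nat.find_spec hex) with h1 | h1 <;> omega
    · push Not at hex
      exact ⟨n, le_rfl, fun i _ => hex i, fun h => absurd h (lt_irrefl _)⟩
  have hjn' : j < n → j + 2 ≤ n := fun hlt' => by
    rcases h.adjProj_of_hasGap hlt (hj hlt') with h1 | h1 <;> omega
  have habove : ∀ i, j ≤ i → i + 2 ≤ n → HasGap i U := by
    intro i hji hin
    induction i, hji using Nat.le_induction with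
    | base => exact hj (by omega)
    | succ i hji ih =>
      rcases h.adjProj_of_hasGap hlt (ih (by omega)) with h1 | h1
      · omega
      · exact h1.2.2
  have hzero : 0 < j → U.count 0 ≤ 1 := by
    intro hj0
    by_contra hcon
    obtain ⟨x, y, z, hU, -, hy⟩ := List.exists_two_of_two_le_count
      (show 2 ≤ U.count 0 by omega)
    exact hjmin 0 hj0 ⟨x, y, z, hU, hy, fun b _ => by omega⟩
  have halt : ∀ i, i + 1 < j → adjProj i U = [] ∨
      (U.count i = U.count (i + 1) + 1 ∧
        adjProj i U = alternatingList i (i + 1) (U.count i + U.count (i + 1))) ∨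
      (U.count (i + 1) = U.count i + 1 ∧
        adjProj i U = alternatingList (i + 1) i (U.count i + U.count (i + 1))) := by
    intro i hi
    have := eq_alternatingList_of_reverse_eq (a := i) (b := i + 1) (by omega)
      (fun x hx => (mem_adjProj.1 hx).2)
      (h.isChain_adjProj (by omega) (hjmin (i + 1) hi)) (hpal i)
    rwa [count_adjProj_self, count_adjProj_succ] at this
  have hnil : ∀ i, adjProj i U = [] → U.count i = 0 ∧ U.count (i + 1) = 0 := by
    intro i hi
    rw [adjProj_eq_nil_iff] at hi
    exact ⟨List.count_eq_zero_of_not_mem hi.1, List.count_eq_zero_of_not_mem hi.2⟩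
  set A₀ : Finset ℕ := (Finset.range j).filter fun k =>
    ∀ i, (i + 1 = k → U.count i < U.count k) ∧ (k = 0 → U.count 0 = 1) with hA₀
  have hheight : ∀ k < j, height A₀ (k + 1) = U.count k := by
    intro k hk
    induction k with
    | zero =>
      have h1 := hzero hk
      have h2 : 0 ∈ A₀ ↔ U.count 0 = 1 := by simp [hA₀, hk]
      simp only [height, h2]
      split_ifs <;> omega
    | succ k ih =>
      have h2 : k + 1 ∈ A₀ ↔ U.count k < U.count (k + 1) := by
        simp only [hA₀, Finset.mem_filter, Finset.mem_range, hk, true_and]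
        constructor
        · intro h3
          exact (h3 k).1 rfl
        · intro h3 i
          refine ⟨fun h4 => ?_, fun h4 => by omega⟩
          obtain rfl : i = k := by omega
          exact h3
      rw [height, ih (by omega)]
      simp only [h2]
      rcases halt k hk with h3 | ⟨h3, -⟩ | ⟨h3, -⟩
      · have := hnil k h3
        split_ifs <;> omega
      · split_ifs <;> omega
      · split_ifs <;> omega
  have hlow : ∀ A, (∀ k < j, k ∈ A ↔ k ∈ A₀) → ∀ i, i + 1 < j →
      adjProj i U = fcProj n j A i := by
    intro A hA i hi
    rw [fcProj, if_pos hi]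
    have e : ∀ k < j, height A (k + 1) = U.count k := fun k hk => by
      rw [← hheight k hk]
      exact height_congr fun l hl => hA l (by omega)
    rw [e i (by omega), e (i + 1) hi]
    rcases halt i hi with h3 | ⟨h3, h4⟩ | ⟨h3, h4⟩
    · have := hnil i h3
      rw [if_neg (by omega), this.1, this.2, h3]
      rfl
    · rw [if_neg (by omega)]
      exact h4
    · rw [if_pos (by omega)]
      exact h4
  have hsub : A₀ ⊆ Finset.range j := Finset.filter_subset _ _
  have hempty : ∀ i, n ≤ i → adjProj i U = [] := fun i hi =>
    adjProj_eq_nil_iff.2 ⟨hge i hi, hge _ (by omega)⟩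
  have hlast : ∀ i, i + 1 = n → adjProj i U = List.replicate (U.count i) i := by
    intro i hi
    rw [← count_adjProj_self, List.eq_replicate_iff, eq_comm, List.count_eq_length]
    have h1 : ∀ b ∈ adjProj i U, b = i := by
      intro b hb
      obtain ⟨h1, rfl | rfl⟩ := mem_adjProj.1 hb
      · rfl
      · exact absurd h1 (hge _ (by omega))
    exact ⟨fun b hb => (h1 b hb).symm, h1⟩
  rcases hjn.eq_or_lt with rfl | hjlt
  · refine ⟨j, A₀, Or.inl ⟨rfl, hsub⟩, fun i => ?_⟩
    rcases lt_trichotomy (i + 1) j with hi | hi | hi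
    · exact hlow A₀ (fun _ _ => Iff.rfl) i hi
    · rw [fcProj, if_neg (by omega), if_pos hi, if_pos rfl, hlast i hi, ← hi,
        hheight i (by omega)]
    · rw [fcProj, if_neg (by omega), if_neg (by omega), if_neg (by omega), if_neg (by omega),
        if_neg (by omega), hempty i (by omega)]
  · have hj2 := hjn' hjlt
    have hcj : U.count j = 2 := by
      rw [← count_adjProj_self]
      rcases h.adjProj_of_hasGap hlt (hj hjlt) with h1 | h1
      · rw [h1.2]; simp
      · rw [h1.2.1]; simp
    have hprev : ∀ i, i + 1 = j → (U.count i = 0 ∧ adjProj i U = [i + 1, i + 1]) ∨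
        (U.count i = 2 ∧ adjProj i U = [i, i + 1, i + 1, i]) := by
      rintro i rfl
      obtain ⟨x, y, z, hU, hy, hy'⟩ := hj hjlt
      have hcj' := hcj
      rw [hU] at hcj'
      simp only [List.count_append, List.count_cons_self] at hcj'
      have hx : i + 1 ∉ x := by rw [← List.count_eq_zero]; omega
      have hz : i + 1 ∉ z := by rw [← List.count_eq_zero]; omega
      have hrep : ∀ w : List ℕ, i + 1 ∉ w → adjProj i w = List.replicate (w.count i) i := by
        intro w hw
        rw [← List.filter_beq]
        apply List.filter_congr
        intro b hb
        have : b ≠ i + 1 := by rintro rfl; exact hw hb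
        by_cases hbi : b = i <;> simp [hbi, this]
      have hyi : i ∉ y := fun hm => hy' i hm rfl
      have hp : adjProj i U = List.replicate (x.count i) i ++
          ([i + 1, i + 1] ++ List.replicate (z.count i) i) := by
        simp [hU, adjProj_cons, hrep x hx, hrep z hz, adjProj_eq_nil_iff.2 ⟨hyi, hy⟩]
      have hx1 : x.count i ≤ 1 := by
        by_contra hcon
        obtain ⟨x1, x2, x3, rfl, -, hx2⟩ := List.exists_two_of_two_le_count
          (show 2 ≤ x.count i by omega)
        refine hx ?_
        have := h.succ_mem (by omega) (x := x1) (y := x2)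
          (z := x3 ++ (i + 1) :: (y ++ (i + 1) :: z)) (by simp [hU]) hx2
        simp [this]
      have hz1 : z.count i ≤ 1 := by
        by_contra hcon
        obtain ⟨x1, x2, x3, rfl, -, hx2⟩ := List.exists_two_of_two_le_count
          (show 2 ≤ z.count i by omega)
        refine hz ?_
        have := h.succ_mem (by omega) (x := x ++ (i + 1) :: (y ++ (i + 1) :: x1)) (y := x2)
          (z := x3) (by simp [hU]) hx2
        simp [this]
      have hpi := hpal i
      rw [← count_adjProj_self, hp]
      rw [hp] at hpi
      generalize x.count i = p at hx1 hpi
      generalize z.count i = q at hz1 hpi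
      interval_cases p <;> interval_cases q <;> simp at hpi ⊢
    have hge' : ∀ A i, j ≤ i → adjProj i U = fcProj n j A i := by
      intro A i hi
      rw [fcProj, if_neg (by omega), if_neg (by omega)]
      rcases lt_trichotomy (i + 1) n with h1 | h1 | h1
      · rcases h.adjProj_of_hasGap hlt (habove i hi (by omega)) with h2 | h2
        · rw [if_neg (by omega), if_pos h2.1, h2.2]
        · rw [if_pos h2.1, h2.2.1]
      · rw [if_neg (by omega), if_neg (by omega), if_pos h1, hlast i h1]
        obtain ⟨k, rfl⟩ : ∃ k, i = k + 1 := ⟨i - 1, by omega⟩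
        rcases h.adjProj_of_hasGap hlt (habove k (by omega) (by omega)) with h2 | h2
        · rw [← count_adjProj_succ, h2.2]
          simp
        · omega
      · rw [if_neg (by omega), if_neg (by omega), if_neg (by omega), hempty i (by omega)]
    have hassemble : ∀ A, (∀ k < j, k ∈ A ↔ k ∈ A₀) → ∀ i, adjProj i U = fcProj n j A i := by
      intro A hA i
      rcases lt_trichotomy (i + 1) j with hi | hi | hi
      · exact hlow A hA i hi
      · have e : height A j = U.count i := by
          rw [← hheight i (by omega), hi]
          exact height_congr fun l hl => hA l (by omega)
        rw [fcProj, if_neg (by omega), if_pos hi, if_neg (by omega), e]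
        rcases hprev i hi with h1 | h1
        · rw [if_pos h1.1, h1.2]
        · rw [if_neg (by omega), h1.2]
      · exact hge' A i (by omega)
    have hH : height A₀ j = 0 ∨ height A₀ j = 2 := by
      rcases Nat.eq_zero_or_pos j with rfl | hj0
      · exact Or.inl rfl
      · obtain ⟨k, rfl⟩ : ∃ k, j = k + 1 := ⟨j - 1, by omega⟩
        rw [hheight k (by omega)]
        rcases hprev k rfl with h1 | h1 <;> omega
    have hjA₀ : j ∉ A₀ := fun hm => by simpa using hsub hm
    rcases hH with hH | hH
    · refine ⟨j, insert j A₀, Or.inr ⟨by omega, ?_, ?_⟩, hassemble _ fun k hk => ?_⟩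
      · rw [Finset.range_add_one]
        exact Finset.insert_subset_insert _ hsub
      · have e : height (insert j A₀) j = height A₀ j := height_congr fun l hl => by
          simp [show l ≠ j by omega]
        simp [height, e, hH]
      · simp [show k ≠ j by omega]
    · refine ⟨j, A₀, Or.inr ⟨by omega, hsub.trans (Finset.range_subset_range.2 (by omega)), ?_⟩,
        hassemble _ fun k hk => Iff.rfl⟩
      simp [height, hH, hjA₀]

theorem height_succ_of_mem {A : Finset ℕ} {k : ℕ} (h : k ∈ A) :
    height A (k + 1) = height A k + 1 := if_pos h

theorem height_succ_of_notMem {A : Finset ℕ} {k : ℕ} (h : k ∉ A) :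
    height A (k + 1) = height A k - 1 := if_neg h

theorem height_one_le (A : Finset ℕ) : height A 1 ≤ 1 := by
  by_cases h : 0 ∈ A
  · rw [height_succ_of_mem h, height]
  · rw [height_succ_of_notMem h, height]
    omega

theorem height_lt_iff {A : Finset ℕ} {k : ℕ} : height A k < height A (k + 1) ↔ k ∈ A := by
  by_cases h : k ∈ A
  · rw [height_succ_of_mem h]
    simp [h]
  · rw [height_succ_of_notMem h]
    simp [h]

theorem fcProj_eq_of_lt {n j : ℕ} (A : Finset ℕ) {i : ℕ} (hi : i + 1 < j) :
    (height A (i + 1) = 0 ∧ height A (i + 2) = 0 ∧ i + 1 ∉ A ∧ fcProj n j A i = []) ∨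
    (height A (i + 2) = height A (i + 1) + 1 ∧ i + 1 ∈ A ∧
      fcProj n j A i = alternatingList (i + 1) i (2 * height A (i + 1) + 1)) ∨
    (height A (i + 1) = height A (i + 2) + 1 ∧ i + 1 ∉ A ∧
      fcProj n j A i = alternatingList i (i + 1) (2 * height A (i + 2) + 1)) := by
  rw [fcProj, if_pos hi, show i + 2 = i + 1 + 1 from rfl]
  by_cases h : i + 1 ∈ A
  · right; left
    have h1 := height_succ_of_mem h
    refine ⟨h1, h, ?_⟩
    rw [if_pos (by omega), h1]
    congr 1
    omega
  · have h1 := height_succ_of_notMem h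
    rcases Nat.eq_zero_or_pos (height A (i + 1)) with h2 | h2
    · left
      rw [h2] at h1 ⊢
      rw [h1]
      exact ⟨rfl, rfl, h, rfl⟩
    · right; right
      refine ⟨by omega, h, ?_⟩
      rw [if_neg (by omega)]
      congr 1
      omega

theorem fcProj_eq_of_ge {n j : ℕ} (A : Finset ℕ) {i : ℕ} (hi : j ≤ i) :
    fcProj n j A i = if i + 2 < n then [i, i + 1, i + 1, i]
      else if i + 2 = n then [i, i + 1, i] else if i + 1 = n then [i] else [] := by
  rw [fcProj, if_neg (by omega), if_neg (by omega)]

theorem mem_fcProj {n j : ℕ} {A : Finset ℕ} {i x : ℕ} (h : x ∈ fcProj n j A i) :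
    x = i ∨ x = i + 1 := by
  rcases lt_trichotomy (i + 1) j with hi | hi | hi
  · rcases fcProj_eq_of_lt (n := n) A hi with ⟨-, -, -, h1⟩ | ⟨-, -, h1⟩ | ⟨-, -, h1⟩ <;>
      rw [h1] at h
    · simp at h
    · exact (mem_alternatingList h).symm
    · exact mem_alternatingList h
  · rw [fcProj, if_neg (by omega), if_pos hi] at h
    split_ifs at h
    · exact Or.inl (List.eq_of_mem_replicate h)
    all_goals simp at h; omega
  · rw [fcProj_eq_of_ge A (by omega)] at h
    split_ifs at h <;> simp at h <;> omega

theorem fcProj_eq_nil {n j : ℕ} (A : Finset ℕ) (hj : j ≤ n) {i : ℕ} (hi : n ≤ i) :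
    fcProj n j A i = [] := by
  rw [fcProj_eq_of_ge A (by omega), if_neg (by omega), if_neg (by omega), if_neg (by omega)]

theorem reverse_fcProj (n j : ℕ) (A : Finset ℕ) (i : ℕ) :
    (fcProj n j A i).reverse = fcProj n j A i := by
  rcases lt_trichotomy (i + 1) j with hi | hi | hi
  · rcases fcProj_eq_of_lt (n := n) A hi with ⟨-, -, -, h1⟩ | ⟨-, -, h1⟩ | ⟨-, -, h1⟩ <;>
      rw [h1]
    · rfl
    all_goals rw [reverse_alternatingList, if_neg (by simp)]
  · rw [fcProj, if_neg (by omega), if_pos hi]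
    split_ifs <;> simp
  · rw [fcProj_eq_of_ge A (by omega)]
    split_ifs <;> simp

/-- The number of occurrences of each letter in the word with projections `fcProj n j A`. -/
def fcCount (n j : ℕ) (A : Finset ℕ) (i : ℕ) : ℕ :=
  if i < j then height A (i + 1) else if i + 1 < n then 2 else if i + 1 = n then 1 else 0

namespace IsFCParam

variable {n j : ℕ} {A : Finset ℕ}

theorem le (h : IsFCParam n j A) : j ≤ n := by
  rcases h with ⟨h, -⟩ | ⟨h, -⟩ <;> omega

theorem height_cases (h : IsFCParam n j A) (hj : j < n) :
    j + 1 < n ∧ (height A j = 0 ∧ j ∈ A ∨ height A j = 2 ∧ j ∉ A) := by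
  rcases h with ⟨h, -⟩ | ⟨h, -, h1⟩
  · omega
  · refine ⟨h, ?_⟩
    by_cases hA : j ∈ A
    · rw [height_succ_of_mem hA] at h1
      exact Or.inl ⟨by omega, hA⟩
    · rw [height_succ_of_notMem hA] at h1
      exact Or.inr ⟨by omega, hA⟩

theorem lt_of_mem (h : IsFCParam n j A) {i : ℕ} (hi : i ∈ A) : i < n ∧ i ≤ j := by
  rcases h with ⟨rfl, h⟩ | ⟨h1, h, -⟩
  · have := Finset.mem_range.1 (h hi)
    omega
  · have := Finset.mem_range.1 (h hi)
    omega

theorem count_fcProj (h : IsFCParam n j A) (i : ℕ) :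
    (fcProj n j A i).count i = fcCount n j A i ∧
      (fcProj n j A i).count (i + 1) = fcCount n j A (i + 1) := by
  have hle := h.le
  rcases lt_trichotomy (i + 1) j with hi | hi | hi
  · rw [fcCount, fcCount, if_pos (by omega), if_pos hi, show i + 1 + 1 = i + 2 from rfl]
    rcases fcProj_eq_of_lt (n := n) A hi with ⟨h2, h3, -, h1⟩ | ⟨h2, -, h1⟩ | ⟨h2, -, h1⟩ <;>
      rw [h1]
    · simp [h2, h3]
    · have := count_alternatingList_odd (show i + 1 ≠ i by omega) (height A (i + 1))
      omega
    · have := count_alternatingList_odd (show i ≠ i + 1 by omega) (height A (i + 2))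
      omega
  · rw [fcCount, fcCount, if_pos (by omega), if_neg (by omega), fcProj, if_neg (by omega),
      if_pos hi]
    rcases h.le.eq_or_lt with hj | hj
    · rw [if_pos hj, if_neg (by omega), if_neg (by omega), hi, List.count_replicate_self,
        List.count_replicate, if_neg (by simp; omega)]
      simp
    · subst hi
      obtain ⟨h1, ⟨h2, -⟩ | ⟨h2, -⟩⟩ := h.height_cases hj <;> simp [h1, h2, hj.ne]
  · have h1 : ¬i < j := by omega
    have h2 : ¬i + 1 < j := by omega
    rw [fcProj_eq_of_ge A (by omega)]
    simp only [fcCount, h1, h2, if_false]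
    split_ifs <;> first | omega | simp

theorem exists_word (h : IsFCParam n j A) :
    ∃ U : List ℕ, (∀ x ∈ U, x < n) ∧ ∀ i, adjProj i U = fcProj n j A i := by
  obtain ⟨U, hU⟩ := exists_adjProj_eq (fcProj n j A) (fun i x hx => mem_fcProj hx)
    (fun i => by rw [(h.count_fcProj i).2, (h.count_fcProj (i + 1)).1]) n
    (fun i hi => fcProj_eq_nil A h.le hi)
  refine ⟨U, fun x hx => ?_, hU⟩
  by_contra hn
  have h1 := hU x
  rw [fcProj_eq_nil A h.le (by omega), adjProj_eq_nil_iff] at h1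
  exact h1.1 hx

theorem not_infix_succ_succ {i : ℕ} (hi : i + 1 < j) (A : Finset ℕ) (a : ℕ) :
    ¬[a, a] <:+: fcProj n j A i := by
  intro h1
  have h2 : (fcProj n j A i).IsChain (· ≠ ·) := by
    rcases fcProj_eq_of_lt (n := n) A hi with ⟨-, -, -, h1⟩ | ⟨-, -, h1⟩ | ⟨-, -, h1⟩ <;>
      rw [h1]
    · exact List.isChain_nil
    · exact isChain_alternatingList (by omega) _
    · exact isChain_alternatingList (by omega) _
  have h3 := h2.infix h1
  simp at h3

theorem not_infix_self_self (h : IsFCParam n j A) {a : ℕ} (ha : a + 1 < n) :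
    ¬[a, a] <:+: fcProj n j A a := by
  have hle := h.le
  rcases lt_trichotomy (a + 1) j with hi | hi | hi
  · exact not_infix_succ_succ hi A a
  · rw [fcProj, if_neg (by omega), if_pos hi, if_neg (by omega)]
    split_ifs <;> simp [List.infix_cons_iff]
  · rw [fcProj_eq_of_ge A (by omega)]
    split_ifs <;> simp [List.infix_cons_iff]

theorem fcCount_zero_le (h : 0 < j) : fcCount n j A 0 ≤ 1 := by
  rw [fcCount, if_pos h]
  exact height_one_le A

theorem avoidsBraidsB (h : IsFCParam n j A) {U : List ℕ} (hU : ∀ i, adjProj i U = fcProj n j A i)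
    (hlt : ∀ x ∈ U, x < n) : AvoidsBraidsB n U := by
  have hle := h.le
  intro V hV
  have hin : ∀ {W : List ℕ}, W <:+: V → ∀ i, adjProj i W <:+: fcProj n j A i := by
    rintro W ⟨x, y, rfl⟩ i
    rw [← hU, hV i]
    exact ⟨adjProj i x, adjProj i y, by simp⟩
  have hlt' : ∀ {W : List ℕ}, W <:+: V → ∀ x ∈ W, x < n := fun hW x hx =>
    hlt x ((hV.mem_iff x).2 (hW.subset hx))
  have hcount : ∀ {W : List ℕ}, W <:+: V → 0 < j → W.count 0 ≤ 1 := by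
    intro W hW hj
    have h1 := (hin hW 0).sublist.count_le 0
    rw [(h.count_fcProj 0).1, count_adjProj_self] at h1
    exact h1.trans (fcCount_zero_le hj)
  refine ⟨fun a hW => ?_, fun a b hab ha hb hW => ?_, fun a b hab hn hW => ?_⟩
  · have h1 := hlt' hW a (by simp)
    rcases Nat.lt_or_ge (a + 1) n with h2 | h2
    · refine h.not_infix_self_self h2 ?_
      simpa [adjProj_cons] using hin hW a
    · rcases a with _ | a
      · have h3 := h.height_cases
        have h4 := hcount hW (by omega)
        simp at h4
      · have h3 := hin hW a
        simp only [adjProj_cons, or_true, if_true, adjProj_nil] at h3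
        rcases hle.eq_or_lt with hj | hj
        · exact not_infix_succ_succ (by omega) A _ h3
        · have := h.height_cases hj
          rw [fcProj_eq_of_ge A (by omega), if_neg (by omega), if_pos (by omega)] at h3
          simp [List.infix_cons_iff] at h3
  · have ha' := hlt' hW a (by simp)
    have hb' := hlt' hW b (by simp)
    rcases hab with rfl | rfl
    · rcases Nat.lt_or_ge a j with hj | hj
      · rcases a with _ | a
        · have h4 := hcount hW (by omega)
          simp at h4
        · have h3 := hin hW a
          simp [adjProj_cons, show a + 1 + 1 ≠ a by omega] at h3
          exact not_infix_succ_succ (by omega) A _ h3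
      · have h3 := hin hW a
        rw [fcProj_eq_of_ge A hj, if_pos (by omega)] at h3
        simp [adjProj_cons, List.infix_cons_iff] at h3
    · refine h.not_infix_self_self (a := b + 1) (by omega) ?_
      simpa [adjProj_cons, show b ≠ b + 1 + 1 by omega] using hin hW (b + 1)
  · have ha' := hlt' hW a (by simp)
    have hb' := hlt' hW b (by simp)
    rcases hle.eq_or_lt with hj | hj
    · have hcases : ∃ l, l + 2 = n ∧ (a = l ∧ b = l + 1 ∨ a = l + 1 ∧ b = l) := by
        rcases hab with rfl | rfl
        · exact ⟨a, by omega, Or.inl ⟨rfl, rfl⟩⟩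
        · exact ⟨b, by omega, Or.inr ⟨rfl, rfl⟩⟩
      obtain ⟨l, hl, hab'⟩ := hcases
      rcases l with _ | l
      · have h4 := hcount hW (by omega)
        rcases hab' with ⟨rfl, rfl⟩ | ⟨rfl, rfl⟩ <;> simp at h4
      · have h3 := hin hW l
        refine not_infix_succ_succ (i := l) (j := j) (n := n) (by omega) A (l + 1) ?_
        rcases hab' with ⟨rfl, rfl⟩ | ⟨rfl, rfl⟩ <;>
          simpa [adjProj_cons, show l + 1 + 1 ≠ l by omega] using h3
    · have := h.height_cases hj
      have h3 := (hin hW (n - 2)).length_le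
      rw [fcProj_eq_of_ge A (by omega), if_neg (by omega), if_pos (by omega)] at h3
      have e : adjProj (n - 2) [a, b, a, b] = [a, b, a, b] := by
        simp only [adjProj_cons, adjProj_nil]
        rw [if_pos (by omega), if_pos (by omega), if_pos (by omega), if_pos (by omega)]
      simp [e] at h3

theorem traceEq_reverse {U : List ℕ} (hU : ∀ i, adjProj i U = fcProj n j A i) :
    TraceEq U.reverse U := fun i => by
  rw [adjProj_reverse, hU, reverse_fcProj]

theorem eq_of_fcProj_eq {j' : ℕ} {A' : Finset ℕ} (h : IsFCParam n j A) (h' : IsFCParam n j' A')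
    (heq : ∀ i, fcProj n j A i = fcProj n j' A' i) : j = j' ∧ A = A' := by
  have hc : ∀ i, fcCount n j A i = fcCount n j' A' i := fun i => by
    rw [← (h.count_fcProj i).1, ← (h'.count_fcProj i).1, heq]
  have key : ∀ {j j' A A'}, IsFCParam n j A → IsFCParam n j' A' →
      (∀ i, fcCount n j A i = fcCount n j' A' i) → ¬j < j' := by
    intro j j' A A' h h' hc hj
    have hle := h'.le
    have h1 := h.height_cases (by omega)
    have h2 := hc j
    rw [fcCount, if_neg (lt_irrefl _), if_pos h1.1, fcCount, if_pos hj] at h2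
    rcases j with _ | j
    · have : height A' (0 + 1) ≤ 1 := height_one_le A'
      omega
    · have h3 := hc j
      rw [fcCount, if_pos (by omega), fcCount, if_pos (by omega)] at h3
      by_cases hA : j + 1 ∈ A'
      · rw [height_succ_of_mem hA] at h2
        omega
      · rw [height_succ_of_notMem hA] at h2
        omega
  obtain rfl : j = j' := le_antisymm (not_lt.1 (key h' h fun i => (hc i).symm))
    (not_lt.1 (key h h' hc))
  refine ⟨rfl, ?_⟩
  have hh : ∀ k ≤ j, height A k = height A' k := by
    rintro (_ | k) hk
    · rfl
    · have := hc k
      rwa [fcCount, fcCount, if_pos (by omega), if_pos (by omega)] at this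
  ext i
  rcases lt_trichotomy i j with hi | rfl | hi
  · rw [← height_lt_iff, ← height_lt_iff, hh i (by omega), hh (i + 1) (by omega)]
  · rcases h.le.eq_or_lt with hi | hi
    · have h1 : i ∉ A := fun hA => by have := h.lt_of_mem hA; omega
      have h2 : i ∉ A' := fun hA => by have := h'.lt_of_mem hA; omega
      simp [h1, h2]
    · have h1 := (h.height_cases hi).2
      have h2 := (h'.height_cases hi).2
      have h3 := hh i le_rfl
      rcases h1 with ⟨h4, h5⟩ | ⟨h4, h5⟩ <;> rcases h2 with ⟨h6, h7⟩ | ⟨h6, h7⟩ <;>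
        first | omega | simp [h5, h7]
  · have h1 : i ∉ A := fun hA => by have := h.lt_of_mem hA; omega
    have h2 : i ∉ A' := fun hA => by have := h'.lt_of_mem hA; omega
    simp [h1, h2]

theorem getLast?_eq_self_iff (h : IsFCParam n j A) {i : ℕ} (hi : i < n) :
    (fcProj n j A i).getLast? = some i ↔ (i < j → 0 < height A (i + 1) ∧ i + 1 ∉ A) := by
  have hle := h.le
  rw [← reverse_fcProj, List.getLast?_reverse]
  rcases lt_trichotomy (i + 1) j with hj | hj | hj
  · rcases fcProj_eq_of_lt (n := n) A hj with ⟨h2, h3, h4, h1⟩ | ⟨h2, h4, h1⟩ | ⟨h2, h4, h1⟩ <;>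
      rw [h1]
    · simp [h2]
      omega
    · simp [alternatingList, h4]
      omega
    · simp [alternatingList, h4]
      omega
  · rw [fcProj, if_neg (by omega), if_pos hj]
    rcases hle.eq_or_lt with hj' | hj'
    · rw [if_pos hj', hj]
      have h1 : j ∉ A := fun hA => by have := h.lt_of_mem hA; omega
      have h2 : i < j := by omega
      simp only [h1, h2, not_false_eq_true, and_true, true_imp_iff]
      rcases height A j with _ | m
      · simp
      · simp [List.replicate_succ]
    · rw [if_neg (by omega)]
      have h2 : i < j := by omega
      obtain ⟨-, ⟨h3, h4⟩ | ⟨h3, h4⟩⟩ := h.height_cases hj' <;> rw [← hj] at h3 h4 h2 ⊢ <;>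
        simp [h3, h4]
  · have h2 : ¬i < j := by omega
    rw [fcProj_eq_of_ge A (by omega)]
    simp only [h2, false_imp_iff, iff_true]
    split_ifs <;> first | omega | rfl

theorem getLast?_eq_succ_iff (h : IsFCParam n j A) {i : ℕ} (hi : i + 1 < n) :
    (fcProj n j A i).getLast? = some (i + 1) ↔ i + 1 ≤ j ∧ i + 1 ∈ A := by
  have hle := h.le
  rw [← reverse_fcProj, List.getLast?_reverse]
  rcases lt_trichotomy (i + 1) j with hj | hj | hj
  · rcases fcProj_eq_of_lt (n := n) A hj with ⟨h2, h3, h4, h1⟩ | ⟨h2, h4, h1⟩ | ⟨h2, h4, h1⟩ <;>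
      rw [h1]
    · simp [h4]
    · simp [alternatingList, h4]
      omega
    · simp [alternatingList, h4]
  · rw [fcProj, if_neg (by omega), if_pos hj, if_neg (by omega)]
    obtain ⟨-, ⟨h3, h4⟩ | ⟨h3, h4⟩⟩ := h.height_cases (by omega) <;> rw [← hj] at h3 h4 ⊢ <;>
      simp [h3, h4]
  · have h2 : ¬i + 1 ≤ j := by omega
    rw [fcProj_eq_of_ge A (by omega)]
    simp only [h2, false_and, iff_false]
    split_ifs <;> simp

theorem getLast?_iff (h : IsFCParam n j A) {i : ℕ} (hi : i < n) :
    ((fcProj n j A i).getLast? = some i ∧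
      ∀ k, k + 1 = i → (fcProj n j A k).getLast? = some i) ↔ i ∈ A ∧ i + 1 ∉ A := by
  have hle := h.le
  rw [h.getLast?_eq_self_iff hi]
  have hnot : j ≤ i → i + 1 ∉ A := fun h1 hA => by have := h.lt_of_mem hA; omega
  rcases i with _ | i
  · have h1 : 0 < height A 1 ↔ 0 ∈ A := height_lt_iff (k := 0)
    rcases Nat.eq_zero_or_pos j with rfl | hj
    · rcases (h.height_cases hi).2 with h2 | h2
      · simp [h2, hnot]
      · simp [height] at h2
    · simp [h1, hj]
  · have h1 := h.getLast?_eq_succ_iff hi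
    have h2 : i + 1 ∈ A → 0 < height A (i + 1 + 1) := fun hA => by
      rw [height_succ_of_mem hA]
      omega
    have h3 : i + 1 ∈ A → i + 1 ≤ j := fun hA => (h.lt_of_mem hA).2
    constructor
    · rintro ⟨h4, h5⟩
      have h6 := h1.1 (h5 i rfl)
      refine ⟨h6.2, fun hA => ?_⟩
      rcases h6.1.eq_or_lt with h7 | h7
      · exact hnot h7.ge hA
      · exact (h4 h7).2 hA
    · rintro ⟨h4, h5⟩
      refine ⟨fun _ => ⟨h2 h4, h5⟩, fun k hk => ?_⟩
      obtain rfl : k = i := by omega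
      exact h1.2 ⟨h3 h4, h4⟩

theorem exists_finWord (h : IsFCParam n j A) :
    ∃ u : List (Fin n), ∀ i, adjProj i (u.map Fin.val) = fcProj n j A i := by
  obtain ⟨U, hlt, hU⟩ := h.exists_word
  exact ⟨U.pmap Fin.mk hlt, by simpa [List.map_pmap] using hU⟩

theorem avoidsBraids (h : IsFCParam n j A) {u : List (Fin n)}
    (hu : ∀ i, adjProj i (u.map Fin.val) = fcProj n j A i) : AvoidsBraids (typeB n) u :=
  avoidsBraids_typeB_iff.2 (h.avoidsBraidsB hu (by simp))

theorem isFCInvolution {W : Type*} [Group W] (cs : CoxeterSystem (typeB n) W)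
    (h : IsFCParam n j A) {u : List (Fin n)}
    (hu : ∀ i, adjProj i (u.map Fin.val) = fcProj n j A i) :
    IsFCInvolution cs (cs.wordProd u) := by
  rw [(h.avoidsBraids hu).isFCInvolution_iff (hasDihedralOrders_typeB cs), commEquiv_typeB_iff,
    List.map_reverse]
  exact (traceEq_reverse hu).symm

theorem majorIndex_eq {W : Type*} [Group W] (cs : CoxeterSystem (typeB n) W)
    (h : IsFCParam n j A) {u : List (Fin n)}
    (hu : ∀ i, adjProj i (u.map Fin.val) = fcProj n j A i) :
    majorIndex cs (cs.wordProd u) = peakSum n A := by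
  have h1 : ∀ i : Fin n, cs.length (cs.wordProd u * cs.simple i) < cs.length (cs.wordProd u) ↔
      (i : ℕ) ∈ A ∧ (i : ℕ) + 1 ∉ A := fun i => by
    rw [← h.getLast?_iff i.2]
    have := isRightDescent_iff_getLast? (cs := cs) (h.avoidsBraids hu) i
    simp only [hu] at this
    exact this
  rw [majorIndex, rightDescents, Finset.sum_filter, peakSum, Finset.sum_range]
  exact Finset.sum_congr rfl fun i _ => by simp only [h1]

end IsFCParam

theorem IsFCInvolution.exists_param {n : ℕ} {W : Type*} [Group W]
    {cs : CoxeterSystem (typeB n) W} {w : W} (h : IsFCInvolution cs w) :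
    ∃ j A u, IsFCParam n j A ∧ (∀ i, adjProj i (u.map Fin.val) = fcProj n j A i) ∧
      cs.wordProd u = w := by
  obtain ⟨u, hlen, rfl⟩ := cs.exists_isReduced w
  have hu : AvoidsBraids (typeB n) u := h.1.avoidsBraids hlen
  have h1 := (hu.isFCInvolution_iff (hasDihedralOrders_typeB cs)).1 h
  rw [commEquiv_typeB_iff, List.map_reverse] at h1
  obtain ⟨j, A, h2, h3⟩ := (avoidsBraids_typeB_iff.1 hu).exists_fcProj (by simp) h1.symm
  exact ⟨j, A, u, h2, h3, rfl⟩

theorem IsFCParam.eq_of_wordProd_eq {n j j' : ℕ} {A A' : Finset ℕ} {W : Type*} [Group W]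
    (cs : CoxeterSystem (typeB n) W) (h : IsFCParam n j A) (h' : IsFCParam n j' A')
    {u u' : List (Fin n)}
    (hu : ∀ i, adjProj i (u.map Fin.val) = fcProj n j A i)
    (hu' : ∀ i, adjProj i (u'.map Fin.val) = fcProj n j' A' i)
    (heq : cs.wordProd u = cs.wordProd u') : j = j' ∧ A = A' := by
  have H := hasDihedralOrders_typeB cs
  have h1 := (h.avoidsBraids hu).commEquiv H ((h'.avoidsBraids hu').isReduced H) heq.symm
  rw [commEquiv_typeB_iff] at h1
  exact h.eq_of_fcProj_eq h' fun i => by rw [← hu, ← hu', h1 i]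

/-- The finite set of parameters of the fully commutative involutions of type `B_n`. -/
def fcParams (n : ℕ) : Finset (Σ _ : ℕ, Finset ℕ) :=
  (insert n (Finset.range (n - 1))).sigma fun j =>
    if j = n then (Finset.range n).powerset
    else (Finset.range (j + 1)).powerset.filter fun A => height A (j + 1) = 1

theorem mem_fcParams {n : ℕ} {p : Σ _ : ℕ, Finset ℕ} :
    p ∈ fcParams n ↔ IsFCParam n p.1 p.2 := by
  obtain ⟨j, A⟩ := p
  simp only [fcParams, IsFCParam, Finset.mem_sigma, Finset.mem_insert, Finset.mem_range]
  by_cases h : j = n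
  · simp [h]
  · simp only [h, false_or, if_false, Finset.mem_filter, Finset.mem_powerset, false_and]
    exact and_congr_left fun _ => by omega

theorem sum_fcParams (n : ℕ) (hn : 1 ≤ n) :
    ∑ p ∈ fcParams n, (Polynomial.X : Polynomial ℤ) ^ peakSum n p.2 =
      (∑ h ∈ Finset.Icc 1 n, Polynomial.X ^ h *
        ∑ i ∈ Finset.range h, qbinom (h - 1) i) + qbinom n (n / 2) := by
  rw [fcParams, Finset.sum_sigma, Finset.sum_insert (by simp), if_pos rfl, sum_peakSum_powerset,
    ← sum_heightGF_one n hn, add_comm (1 : Polynomial ℤ) (∑ h ∈ Finset.Icc 1 n, _), add_assoc]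
  congr 2
  refine Finset.sum_congr rfl fun j hj => ?_
  rw [Finset.mem_range] at hj
  rw [if_neg (by omega), Finset.sum_filter, heightGF]

/-- The sum of `q^{maj(w)}` over all fully commutative involutions `w` of the Coxeter
group of type `B_n` equals
`Σ_{h=1}^{n} q^h Σ_{i=0}^{h-1} [h-1 choose i]_q + [n choose ⌊n/2⌋]_q`. -/
theorem majorIndex_gf_fcInvolutions_typeB (n : ℕ) (hn : 1 ≤ n) :
    ∃ S : Finset (typeB n).Group,
      (∀ w, w ∈ S ↔ IsFCInvolution (typeB n).toCoxeterSystem w) ∧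
      ∑ w ∈ S, (Polynomial.X : Polynomial ℤ) ^ majorIndex (typeB n).toCoxeterSystem w =
        (∑ h ∈ Finset.Icc 1 n, Polynomial.X ^ h *
          ∑ i ∈ Finset.range h, qbinom (h - 1) i) + qbinom n (n / 2) := by
  classical
  let cs := (typeB n).toCoxeterSystem
  have hex : ∀ p : Σ _ : ℕ, Finset ℕ, ∃ u : List (Fin n), p ∈ fcParams n →
      ∀ i, adjProj i (u.map Fin.val) = fcProj n p.1 p.2 i := by
    intro p
    by_cases hp : p ∈ fcParams n
    · obtain ⟨u, hu⟩ := (mem_fcParams.1 hp).exists_finWord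
      exact ⟨u, fun _ => hu⟩
    · exact ⟨[], fun h => absurd h hp⟩
  choose u hu using hex
  refine ⟨(fcParams n).image fun p => cs.wordProd (u p), fun w => ?_, ?_⟩
  · rw [Finset.mem_image]
    constructor
    · rintro ⟨p, hp, rfl⟩
      exact (mem_fcParams.1 hp).isFCInvolution cs (hu p hp)
    · intro hw
      obtain ⟨j, A, v, hA, hv, rfl⟩ := hw.exists_param
      have hp : (⟨j, A⟩ : Σ _ : ℕ, Finset ℕ) ∈ fcParams n := mem_fcParams.2 hA
      refine ⟨_, hp, CommEquiv.wordProd_eq cs (commEquiv_typeB_iff.2 fun i => ?_)⟩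
      rw [hu _ hp, hv]
  · rw [Finset.sum_image, ← sum_fcParams n hn]
    · exact Finset.sum_congr rfl fun p hp => by
        rw [(mem_fcParams.1 hp).majorIndex_eq cs (hu p hp)]
    · intro p hp q hq heq
      obtain ⟨j, A⟩ := p
      obtain ⟨j', A'⟩ := q
      obtain ⟨h1, h2⟩ := (mem_fcParams.1 hp).eq_of_wordProd_eq cs (mem_fcParams.1 hq)
        (hu _ hp) (hu _ hq) heq
      simp only at h1 h2
      rw [h1, h2]
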